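/- Let g > 1 be an integer and let m = (m₁, m₂, …, m_n) be a partition of 2g + n − 2 such that m_i ≥ 2 for each i ∈ {1,…,n}. Then |⟨F_{m₁} | F_{m₂} | ⋯ | F_{m_n}⟩ − |m|! · 𝔷(|m| − n + 2)| ≤ 2^{2^{190}} · (|m| − 1)!. -/

import Mathlib

open Nat Finset

attribute [local instance] Classical.propDecidable

/-- The series `ζ(k) = Σ_{j=1}^∞ j^{−k}` (convergent for `k ≥ 2`). -/
noncomputable def zetaSeries (k : ℤ) : ℝ :=
  ∑' j : ℕ, ((j : ℝ) + 1) ^ (-k)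

/-- `𝔷(k) = (2 − 2^{2−k}) ζ(k)` for even integers `k ≥ 2`, `𝔷(0) = 1`, and `𝔷(k) = 0`
for all other integers `k` (in particular for odd or negative `k`). -/
noncomputable def zed (k : ℤ) : ℝ :=
  if k = 0 then 1
  else if 2 ≤ k ∧ Even k then (2 - (2 : ℝ) ^ (2 - k)) * zetaSeries k
  else 0

/-- `P` is a (reduced) set partition of the finite set `S`: a collection of nonempty
disjoint subsets of `S` whose union is `S` (each element of `S` lies in exactly one
component). -/
def IsSetPartitionOn {ι : Type*} [DecidableEq ι] (S : Finset ι) (P : Finset (Finset ι)) :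
    Prop :=
  (∀ s ∈ P, s ⊆ S ∧ s ≠ ∅) ∧ ∀ x ∈ S, ∃! s, s ∈ P ∧ x ∈ s

/-- `P` refines `Q`: every component of `P` is contained in a component of `Q`. -/
def Refines {ι : Type*} (P Q : Finset (Finset ι)) : Prop :=
  ∀ s ∈ P, ∃ t ∈ Q, s ⊆ t

/-- Two set partitions `α`, `β` of a finite type `ι` (with `n = |ι|` elements) are
complementary if `ℓ(α) + ℓ(β) = n + 1` and the minimal set partition refined by both
`α` and `β` is the maximal (one-component) set partition; equivalently, the only common
coarsening of `α` and `β` is the one-component partition. -/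
def IsComplementary {ι : Type*} [Fintype ι] [DecidableEq ι]
    (α β : Finset (Finset ι)) : Prop :=
  α.card + β.card = Fintype.card ι + 1 ∧
    ∀ γ : Finset (Finset ι), IsSetPartitionOn Finset.univ γ →
      Refines α γ → Refines β γ → γ = {Finset.univ}

/-- The quantity `E(m)` of Eskin–Okounkov, for a weight function `v` on a finite ground
set `S`:
`E = Σ_{P partition of S, ℓ(P) ≥ 2} (−1)^{ℓ(P)−1} (ℓ(P)−2)!
      Σ_{d : P → ℕ, Σ d = ℓ(P)−2} ∏_{s ∈ P} (1/d_s!) · |v_s|! · 𝔷(|v_s| − |s| − d_s + 1)`,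
where `|v_s| = Σ_{x ∈ s} v(x)` and `|s|` is the cardinality of the component `s`. -/
noncomputable def Emap {ι : Type*} [Fintype ι] [DecidableEq ι]
    (S : Finset ι) (v : ι → ℕ) : ℝ :=
  ∑ P ∈ Finset.univ.filter
      (fun P : Finset (Finset ι) => IsSetPartitionOn S P ∧ 2 ≤ P.card),
    (-1 : ℝ) ^ (P.card - 1) * ((P.card - 2)! : ℝ) *
      ∑ d ∈ Finset.finsuppAntidiag P (P.card - 2),
        ∏ s ∈ P,
          (1 / ((d s)! : ℝ) * ((∑ x ∈ s, v x)! : ℝ) *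
            zed ((∑ x ∈ s, v x : ℤ) - s.card - d s + 1))

/-- The single-bracket inner product `⟨m⟩ = |m|! · 𝔷(|m| − n + 2) + E(m)`, where the
entries of the tuple `m` are the values of `v` on the `n`-element ground set `S`. -/
noncomputable def innerSingle {ι : Type*} [Fintype ι] [DecidableEq ι]
    (S : Finset ι) (v : ι → ℕ) : ℝ :=
  ((∑ x ∈ S, v x)! : ℝ) * zed ((∑ x ∈ S, v x : ℤ) - S.card + 2) + Emap S v

/-- The multi-fold inner product `⟨p_{λ^(1)} | ⋯ | p_{λ^(n)}⟩`.  The data of the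
partitions `λ^(1), …, λ^(n)` is encoded by a ground set `ι` of size `L` (positions of
all parts), the value map `v : ι → ℕ` recording the parts, and the set partition `ρ`
of `ι` whose components group the positions belonging to the same `λ^(j)`.  Then
`⟨p_{λ^(1)} | ⋯ | p_{λ^(n)}⟩ = Σ_{α ∈ 𝒞(ρ)} ∏_{s ∈ α} ⟨λ_s⟩`, the sum running over set
partitions `α` of `ι` complementary to `ρ`, where `λ_s` is the tuple of parts at the
positions in the component `s`. -/
noncomputable def innerMulti {ι : Type*} [Fintype ι] [DecidableEq ι]
    (ρ : Finset (Finset ι)) (v : ι → ℕ) : ℝ :=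
  ∑ α ∈ Finset.univ.filter
      (fun α : Finset (Finset ι) =>
        IsSetPartitionOn Finset.univ α ∧ IsComplementary ρ α),
    ∏ s ∈ α, innerSingle s v

/-- The finite set of all partitions, encoded as multisets of positive integers, of
weight `w` (i.e. with `|λ| + ℓ(λ) = w`).  Adding `1` to each part is a bijection between
such partitions and the partitions of `w` all of whose parts are `≥ 2`, which is used
here to realize this family as a `Finset`. -/
noncomputable def partitionsOfWeight (w : ℕ) : Finset (Multiset ℕ) :=
  ((Finset.univ : Finset (Nat.Partition w)).filter fun μ => ∀ p ∈ μ.parts, 2 ≤ p).image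
    fun μ => μ.parts.map fun p => p - 1

/-- The inner product `⟨F_{m₁} | ⋯ | F_{m_n}⟩` (with `F_k = k·𝔣_k`):
`Σ_{wt(λ^(1)) = m₁+1} ⋯ Σ_{wt(λ^(n)) = m_n+1} ⟨p_{λ^(1)}|…|p_{λ^(n)}⟩ ·
  ∏_j (−m_j)^{ℓ(λ^(j))−1} / ∏_{i ≥ 1} M_i(λ^(j))!`.
For each tuple `T` of partitions, the multi-fold inner product is computed on the
ground set `Σ j, Fin ℓ(T j)` with `ρ` the partition into the fibers of the first
projection and the value map enumerating the parts of each `T j`. -/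
noncomputable def innerF {n : ℕ} (m : Fin n → ℕ) : ℝ :=
  ∑ T ∈ Fintype.piFinset fun j : Fin n => partitionsOfWeight (m j + 1),
    innerMulti
      (Finset.univ.image fun j : Fin n =>
        Finset.univ.filter fun x : Σ j : Fin n, Fin (T j).toList.length => x.1 = j)
      (fun x => (T x.1).toList.get x.2) *
      ∏ j, ((-(m j : ℝ)) ^ (Multiset.card (T j) - 1) /
        ∏ i ∈ (T j).toFinset, (((T j).count i)! : ℝ))

theorem zetaSeries_le_of_four_le {k : ℤ} (hk : 4 ≤ k) : zetaSeries k ≤ 7 / 6 := by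
  have h4 : HasSum (fun j : ℕ => 1 / ((j : ℝ) + 1) ^ 4) (Real.pi ^ 4 / 90) := by
    have h := (hasSum_nat_add_iff' 1).mpr hasSum_zeta_four
    simpa using h
  have hle : ∀ j : ℕ, ((j : ℝ) + 1) ^ (-k) ≤ 1 / ((j : ℝ) + 1) ^ 4 := by
    intro j
    have h1 : (1 : ℝ) ≤ (j : ℝ) + 1 := by
      have : (0 : ℝ) ≤ j := by positivity
      linarith
    have h2 := zpow_le_zpow_right₀ h1 (show -k ≤ (-4 : ℤ) by omega)
    refine h2.trans (le_of_eq ?_)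
    rw [zpow_neg, one_div]
    norm_cast
  have hs : Summable fun j : ℕ => ((j : ℝ) + 1) ^ (-k) :=
    Summable.of_nonneg_of_le (fun j => by positivity) hle h4.summable
  have hz : zetaSeries k ≤ Real.pi ^ 4 / 90 := by
    rw [← h4.tsum_eq]
    exact hs.tsum_le_tsum hle h4.summable
  have hpi : Real.pi ^ 4 ≤ 3.15 ^ 4 := by
    gcongr
    exact Real.pi_lt_d2.le
  norm_num at hpi
  linarith

theorem zetaSeries_two_le : zetaSeries 2 ≤ 7 / 3 := by
  have h2 : HasSum (fun j : ℕ => 1 / ((j : ℝ) + 1) ^ 2) (Real.pi ^ 2 / 6) := by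
    have h := (hasSum_nat_add_iff' 1).mpr hasSum_zeta_two
    simpa using h
  have hz : zetaSeries 2 = Real.pi ^ 2 / 6 := by
    rw [← h2.tsum_eq]
    refine tsum_congr fun j => ?_
    rw [zpow_neg, one_div]
    norm_cast
  have hpi : Real.pi ^ 2 ≤ 3.15 ^ 2 := by
    gcongr
    exact Real.pi_lt_d2.le
  norm_num at hpi
  rw [hz]
  linarith

theorem abs_zed_le (k : ℤ) : |zed k| ≤ 7 / 3 := by
  unfold zed
  split_ifs with h0 h2
  · norm_num
  · obtain ⟨h2, he⟩ := h2
    have hz0 : 0 ≤ zetaSeries k := tsum_nonneg fun j => by positivity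
    have hp : (0 : ℝ) < 2 ^ (2 - k) := by positivity
    have hp1 : (2 : ℝ) ^ (2 - k) ≤ 1 := by
      have := zpow_le_zpow_right₀ (show (1 : ℝ) ≤ 2 by norm_num) (show 2 - k ≤ 0 by omega)
      simpa using this
    rw [abs_of_nonneg (mul_nonneg (by linarith) hz0)]
    rcases h2.eq_or_lt with h | h
    · subst h
      have := zetaSeries_two_le
      norm_num
      linarith
    · have hk : 4 ≤ k := by
        obtain ⟨c, hc⟩ := he
        omega
      have := zetaSeries_le_of_four_le hk
      nlinarith
  · norm_num

/-- The weight `ℓ! 7^ℓ ∏ |v_s|!` of a set partition with `ℓ` components. -/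
noncomputable def partitionWeight {ι : Type*} (v : ι → ℕ) (P : Finset (Finset ι)) : ℝ :=
  (P.card)! * 7 ^ P.card * ∏ s ∈ P, ((∑ x ∈ s, v x)! : ℝ)

theorem partitionWeight_nonneg {ι : Type*} (v : ι → ℕ) (P : Finset (Finset ι)) :
    0 ≤ partitionWeight v P := by
  unfold partitionWeight
  positivity

section SetPartitions

variable {ι : Type*} [DecidableEq ι]

theorem IsSetPartitionOn.pairwiseDisjoint {S : Finset ι} {P : Finset (Finset ι)}
    (h : IsSetPartitionOn S P) : (P : Set (Finset ι)).PairwiseDisjoint id := by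
  intro s hs t ht hst
  rw [Function.onFun, id, id, Finset.disjoint_left]
  intro x hxs hxt
  exact hst ((h.2 x ((h.1 s hs).1 hxs)).unique ⟨hs, hxs⟩ ⟨ht, hxt⟩)

theorem IsSetPartitionOn.biUnion_eq {S : Finset ι} {P : Finset (Finset ι)}
    (h : IsSetPartitionOn S P) : P.biUnion id = S := by
  ext x
  simp only [Finset.mem_biUnion, id]
  constructor
  · rintro ⟨s, hs, hx⟩
    exact (h.1 s hs).1 hx
  · intro hx
    obtain ⟨s, hs, -⟩ := h.2 x hx
    exact ⟨s, hs⟩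

theorem IsSetPartitionOn.prod_prod {M : Type*} [CommMonoid M] {S : Finset ι}
    {P : Finset (Finset ι)} (h : IsSetPartitionOn S P) (f : ι → M) :
    ∏ s ∈ P, ∏ x ∈ s, f x = ∏ x ∈ S, f x := by
  rw [← h.biUnion_eq, Finset.prod_biUnion h.pairwiseDisjoint]
  rfl

theorem IsSetPartitionOn.erase {S A : Finset ι} {P : Finset (Finset ι)}
    (h : IsSetPartitionOn S P) (hA : A ∈ P) : IsSetPartitionOn (S \ A) (P.erase A) := by
  refine ⟨fun s hs => ?_, fun x hx => ?_⟩
  · rw [Finset.mem_erase] at hs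
    refine ⟨fun x hx => ?_, (h.1 s hs.2).2⟩
    rw [Finset.mem_sdiff]
    refine ⟨(h.1 s hs.2).1 hx, fun hxA => hs.1 ?_⟩
    exact (h.2 x ((h.1 s hs.2).1 hx)).unique ⟨hs.2, hx⟩ ⟨hA, hxA⟩
  · rw [Finset.mem_sdiff] at hx
    obtain ⟨s, hs, hu⟩ := h.2 x hx.1
    refine ⟨s, ⟨Finset.mem_erase.2 ⟨?_, hs.1⟩, hs.2⟩, fun t ht => hu t ⟨Finset.mem_of_mem_erase ht.1, ht.2⟩⟩
    rintro rfl
    exact hx.2 hs.2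

theorem isSetPartitionOn_empty_iff {P : Finset (Finset ι)} :
    IsSetPartitionOn ∅ P ↔ P = ∅ := by
  constructor
  · intro h
    refine Finset.eq_empty_of_forall_notMem fun s hs => ?_
    exact (h.1 s hs).2 (Finset.subset_empty.1 (h.1 s hs).1)
  · rintro rfl
    exact ⟨by simp, by simp⟩

theorem IsSetPartitionOn.eq_singleton {S : Finset ι} {P : Finset (Finset ι)}
    (h : IsSetPartitionOn S P) (hS : S ∈ P) : P = {S} := by
  refine Finset.eq_singleton_iff_unique_mem.2 ⟨hS, fun t ht => ?_⟩
  obtain ⟨x, hx⟩ := Finset.nonempty_iff_ne_empty.2 (h.1 t ht).2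
  have hxS := (h.1 t ht).1 hx
  exact (h.2 x hxS).unique ⟨ht, hx⟩ ⟨hS, hxS⟩

theorem partitionWeight_eq_sum (v : ι → ℕ) {P : Finset (Finset ι)} (hP : P.Nonempty) :
    partitionWeight v P =
      ∑ A ∈ P, 7 * ((∑ x ∈ A, v x)! : ℝ) * partitionWeight v (P.erase A) := by
  have hterm : ∀ A ∈ P, 7 * ((∑ x ∈ A, v x)! : ℝ) * partitionWeight v (P.erase A) =
      ((P.card - 1)! : ℝ) * 7 ^ P.card * ∏ s ∈ P, ((∑ x ∈ s, v x)! : ℝ) := by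
    intro A hA
    unfold partitionWeight
    rw [Finset.card_erase_of_mem hA, ← Finset.mul_prod_erase P _ hA]
    obtain ⟨c, hc⟩ := Nat.exists_eq_succ_of_ne_zero (Finset.card_pos.2 hP).ne'
    rw [hc, Nat.succ_sub_one, pow_succ]
    ring
  rw [Finset.sum_congr rfl hterm, Finset.sum_const, nsmul_eq_mul]
  unfold partitionWeight
  rw [← Nat.mul_factorial_pred (Finset.card_pos.2 hP).ne']
  push_cast
  ring

variable [Fintype ι]

/-- The sum of the weights of all set partitions of `S`. -/
noncomputable def totalWeight (v : ι → ℕ) (S : Finset ι) : ℝ :=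
  ∑ P ∈ Finset.univ.filter (fun P : Finset (Finset ι) => IsSetPartitionOn S P),
    partitionWeight v P

theorem totalWeight_empty (v : ι → ℕ) : totalWeight v ∅ = 1 := by
  unfold totalWeight
  simp only [isSetPartitionOn_empty_iff]
  rw [Finset.filter_eq' , if_pos (Finset.mem_univ _), Finset.sum_singleton]
  simp [partitionWeight]

theorem sum_partitionWeight_le (v : ι → ℕ) (S : Finset ι) (F : Finset (Finset (Finset ι)))
    (𝒜 : Finset (Finset ι)) (hF : ∀ P ∈ F, IsSetPartitionOn S P ∧ P.Nonempty ∧ P ⊆ 𝒜) :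
    ∑ P ∈ F, partitionWeight v P ≤
      ∑ A ∈ 𝒜, 7 * ((∑ x ∈ A, v x)! : ℝ) * totalWeight v (S \ A) := by
  calc ∑ P ∈ F, partitionWeight v P
      = ∑ P ∈ F, ∑ A ∈ P, 7 * ((∑ x ∈ A, v x)! : ℝ) * partitionWeight v (P.erase A) :=
        Finset.sum_congr rfl fun P hP => partitionWeight_eq_sum v (hF P hP).2.1
    _ = ∑ A ∈ 𝒜, ∑ P ∈ F.filter (fun P => A ∈ P),
          7 * ((∑ x ∈ A, v x)! : ℝ) * partitionWeight v (P.erase A) := by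
        refine Finset.sum_comm' fun P A => ?_
        simp only [Finset.mem_filter]
        exact ⟨fun h => ⟨⟨h.1, h.2⟩, (hF P h.1).2.2 h.2⟩, fun h => ⟨h.1.1, h.1.2⟩⟩
    _ ≤ _ := by
        refine Finset.sum_le_sum fun A _ => ?_
        rw [← Finset.mul_sum]
        refine mul_le_mul_of_nonneg_left ?_ (by positivity)
        have hinj : Set.InjOn (fun P : Finset (Finset ι) => P.erase A)
            (F.filter (fun P => A ∈ P) : Set (Finset (Finset ι))) := by
          intro P hP Q hQ h
          simp only [Finset.coe_filter, Set.mem_ofPred_eq] at hP hQ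
          rw [← Finset.insert_erase hP.2, ← Finset.insert_erase hQ.2]
          exact congrArg _ h
        rw [← Finset.sum_image (f := partitionWeight v) hinj]
        refine Finset.sum_le_sum_of_subset_of_nonneg ?_ fun _ _ _ => partitionWeight_nonneg _ _
        intro Q hQ
        obtain ⟨P, hP, rfl⟩ := Finset.mem_image.1 hQ
        rw [Finset.mem_filter] at hP ⊢
        exact ⟨Finset.mem_univ _, (hF P hP.1).1.erase hP.2⟩

theorem sum_finsuppAntidiag_prod_inv_factorial_le {κ : Type*} [DecidableEq κ] (P : Finset κ)
    (k : ℕ) : ∑ d ∈ Finset.finsuppAntidiag P k, ∏ s ∈ P, (1 / ((d s)! : ℝ)) ≤ 3 ^ P.card := by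
  have hexp : ∑ i ∈ Finset.range (k + 1), (1 / (i ! : ℝ)) ≤ 3 := by
    have h := Real.sum_le_exp_of_nonneg (show (0 : ℝ) ≤ 1 by norm_num) (k + 1)
    simp only [one_pow] at h
    exact h.trans (by linarith [Real.exp_one_lt_d9])
  calc ∑ d ∈ Finset.finsuppAntidiag P k, ∏ s ∈ P, (1 / ((d s)! : ℝ))
      = ∑ d ∈ Finset.finsuppAntidiag P k, ∏ s ∈ P.attach, (1 / ((d s)! : ℝ)) :=
        Finset.sum_congr rfl fun d _ =>
          (Finset.prod_attach P (fun s => (1 / ((d s)! : ℝ)))).symm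
    _ = ∑ p ∈ (Finset.finsuppAntidiag P k).image
          (fun d => fun (s : κ) (_ : s ∈ P) => d s),
          ∏ s ∈ P.attach, (1 / ((p s.1 s.2)! : ℝ)) := by
        rw [Finset.sum_image]
        intro d hd e he h
        rw [Finset.mem_coe, Finset.mem_finsuppAntidiag] at hd he
        ext s
        by_cases hs : s ∈ P
        · exact congrFun (congrFun h s) hs
        · rw [Finsupp.notMem_support_iff.1 fun h' => hs (hd.2 h'),
            Finsupp.notMem_support_iff.1 fun h' => hs (he.2 h')]
    _ ≤ ∑ p ∈ P.pi (fun _ => Finset.range (k + 1)),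
          ∏ s ∈ P.attach, (1 / ((p s.1 s.2)! : ℝ)) := by
        refine Finset.sum_le_sum_of_subset_of_nonneg ?_
          fun _ _ _ => Finset.prod_nonneg fun _ _ => by positivity
        intro p hp
        obtain ⟨d, hd, rfl⟩ := Finset.mem_image.1 hp
        rw [Finset.mem_finsuppAntidiag] at hd
        rw [Finset.mem_pi]
        intro s hs
        rw [Finset.mem_range, Nat.lt_succ_iff, ← hd.1]
        exact Finset.single_le_sum (f := fun s => d s) (fun _ _ => Nat.zero_le _) hs
    _ = ∏ s ∈ P, ∑ i ∈ Finset.range (k + 1), (1 / (i ! : ℝ)) := by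
        rw [Finset.prod_sum]
    _ ≤ ∏ s ∈ P, 3 := Finset.prod_le_prod (fun _ _ => Finset.sum_nonneg fun _ _ => by positivity)
          fun _ _ => hexp
    _ = 3 ^ P.card := by rw [Finset.prod_const]

theorem abs_Emap_le_sum (S : Finset ι) (v : ι → ℕ) :
    |Emap S v| ≤ ∑ P ∈ Finset.univ.filter
      (fun P : Finset (Finset ι) => IsSetPartitionOn S P ∧ 2 ≤ P.card), partitionWeight v P := by
  unfold Emap
  refine (Finset.abs_sum_le_sum_abs _ _).trans (Finset.sum_le_sum fun P _ => ?_)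
  rw [abs_mul, abs_mul, abs_pow, abs_neg, abs_one, one_pow, one_mul, Nat.abs_cast]
  unfold partitionWeight
  have hfac : ((P.card - 2)! : ℝ) ≤ (P.card)! := by
    exact_mod_cast Nat.factorial_le (Nat.sub_le _ _)
  have hsum : |∑ d ∈ Finset.finsuppAntidiag P (P.card - 2),
        ∏ s ∈ P, (1 / ((d s)! : ℝ) * ((∑ x ∈ s, v x)! : ℝ) *
            zed ((∑ x ∈ s, v x : ℤ) - s.card - d s + 1))| ≤
      7 ^ P.card * ∏ s ∈ P, ((∑ x ∈ s, v x)! : ℝ) := by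
    refine (Finset.abs_sum_le_sum_abs _ _).trans ?_
    calc ∑ d ∈ Finset.finsuppAntidiag P (P.card - 2),
          |∏ s ∈ P, (1 / ((d s)! : ℝ) * ((∑ x ∈ s, v x)! : ℝ) *
            zed ((∑ x ∈ s, v x : ℤ) - s.card - d s + 1))|
        ≤ ∑ d ∈ Finset.finsuppAntidiag P (P.card - 2),
          (∏ s ∈ P, (1 / ((d s)! : ℝ))) *
            ((7 / 3) ^ P.card * ∏ s ∈ P, ((∑ x ∈ s, v x)! : ℝ)) := by
          refine Finset.sum_le_sum fun d _ => ?_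
          rw [Finset.abs_prod, ← Finset.prod_const, ← Finset.prod_mul_distrib,
            ← Finset.prod_mul_distrib]
          refine Finset.prod_le_prod (fun _ _ => abs_nonneg _) fun s _ => ?_
          rw [abs_mul, abs_of_nonneg (by positivity)]
          have h0 : 0 ≤ 1 / ((d s)! : ℝ) * ((∑ x ∈ s, v x)! : ℝ) := by positivity
          nlinarith [abs_zed_le ((∑ x ∈ s, v x : ℤ) - s.card - d s + 1)]
      _ ≤ 3 ^ P.card * ((7 / 3) ^ P.card * ∏ s ∈ P, ((∑ x ∈ s, v x)! : ℝ)) := by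
          rw [← Finset.sum_mul]
          exact mul_le_mul_of_nonneg_right (sum_finsuppAntidiag_prod_inv_factorial_le _ _)
            (by positivity)
      _ = _ := by
          rw [← mul_assoc, ← mul_pow]
          norm_num
  rw [mul_assoc]
  exact mul_le_mul hfac hsum (abs_nonneg _) (by positivity)

end SetPartitions

section Binomial

theorem choose_add_le_choose_add {a b c d : ℕ} (hac : a ≤ c) (hbd : b ≤ d) :
    (a + b).choose a ≤ (c + d).choose c := by
  calc (a + b).choose a ≤ (a + d).choose a := Nat.choose_le_choose a (by omega)
    _ = (a + d).choose d := Nat.choose_symm_add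
    _ ≤ (c + d).choose d := Nat.choose_le_choose d (by omega)
    _ = (c + d).choose c := Nat.choose_symm_add.symm

theorem choose_mul_choose_le_choose_add (m n a b : ℕ) :
    m.choose a * n.choose b ≤ (m + n).choose (a + b) := by
  rw [Nat.add_choose_eq]
  exact Finset.single_le_sum (f := fun ij : ℕ × ℕ => m.choose ij.1 * n.choose ij.2)
    (fun _ _ => Nat.zero_le _) (a := (a, b)) (by simp)

theorem choose_mul_choose_sq_le {a b c d x y : ℕ} (hx : a + 2 * c ≤ x) (hy : b + 2 * d ≤ y) :
    (a + b).choose a * (c + d).choose c ^ 2 ≤ (x + y).choose x := by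
  calc (a + b).choose a * (c + d).choose c ^ 2
      ≤ (a + b).choose a * ((c + d) + (c + d)).choose (c + c) := by
        rw [sq]
        exact Nat.mul_le_mul_left _ (choose_mul_choose_le_choose_add _ _ _ _)
    _ ≤ ((a + b) + ((c + d) + (c + d))).choose (a + (c + c)) :=
        choose_mul_choose_le_choose_add _ _ _ _
    _ = ((a + 2 * c) + (b + 2 * d)).choose (a + 2 * c) := by congr 1 <;> ring
    _ ≤ _ := choose_add_le_choose_add hx hy

theorem choose_le_choose_of_le_of_le_sub {n c a : ℕ} (hca : c ≤ a) (ha : a + c ≤ n) :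
    n.choose c ≤ n.choose a := by
  have hhalf : ∀ a, c ≤ a → a ≤ n / 2 → n.choose c ≤ n.choose a := by
    intro a hca
    induction a, hca using Nat.le_induction with
    | base => exact fun _ => le_rfl
    | succ k hk ih =>
      exact fun h => (ih (by omega)).trans (Nat.choose_le_succ_of_lt_half_left (by omega))
  rcases le_or_gt a (n / 2) with h | h
  · exact hhalf a hca h
  · rw [← Nat.choose_symm (show a ≤ n by omega)]
    exact hhalf _ (by omega) (by omega)

theorem sum_inv_choose_le_one (n : ℕ) :
    ∑ a ∈ Finset.Ico 1 n, (1 / (n.choose a : ℝ)) ≤ 1 := by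
  rcases Nat.eq_zero_or_pos n with rfl | hn
  · simp
  have hn' : (0 : ℝ) < n := by exact_mod_cast hn
  calc ∑ a ∈ Finset.Ico 1 n, (1 / (n.choose a : ℝ))
      ≤ ∑ a ∈ Finset.Ico 1 n, (1 / (n : ℝ)) := by
        refine Finset.sum_le_sum fun a ha => ?_
        rw [Finset.mem_Ico] at ha
        have h := choose_le_choose_of_le_of_le_sub (n := n) ha.1 (by omega)
        rw [Nat.choose_one_right] at h
        exact one_div_le_one_div_of_le hn' (by exact_mod_cast h)
    _ = ((n - 1 : ℕ) : ℝ) / n := by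
        rw [Finset.sum_const, Nat.card_Ico, nsmul_eq_mul, mul_one_div]
    _ ≤ 1 := by
        rw [div_le_one hn']
        exact_mod_cast Nat.sub_le _ _

theorem sum_inv_choose_le (n : ℕ) :
    n * ∑ a ∈ Finset.Ico 1 n, (1 / (n.choose a : ℝ)) ≤ 4 := by
  rcases lt_or_ge n 2 with hn | hn
  · interval_cases n
    · simp
    · simp
  have hn1 : (1 : ℝ) < n := by exact_mod_cast hn
  have hterm : ∀ a ∈ Finset.Ico 1 n, (n : ℝ) * (1 / (n.choose a : ℝ)) ≤
      2 / (n - 1) + ((if a = 1 then 1 else 0) + (if a = n - 1 then 1 else 0)) := by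
    intro a ha
    rw [Finset.mem_Ico] at ha
    have h0 : (0 : ℝ) < 2 / (n - 1) := div_pos two_pos (by linarith)
    by_cases h1 : a = 1
    · subst h1
      rw [Nat.choose_one_right, mul_one_div, div_self (by linarith), if_pos rfl]
      split_ifs <;> linarith
    by_cases h2 : a = n - 1
    · subst h2
      rw [Nat.choose_symm (by omega), Nat.choose_one_right, mul_one_div, div_self (by linarith),
        if_pos rfl]
      split_ifs
      linarith
    · rw [if_neg h1, if_neg h2, add_zero, add_zero]
      have h := choose_le_choose_of_le_of_le_sub (n := n) (c := 2) (a := a) (by omega) (by omega)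
      have hc : (n : ℝ) * (n - 1) / 2 ≤ n.choose a := by
        rw [← Nat.cast_choose_two]
        exact_mod_cast h
      have hpos : (0 : ℝ) < n * (n - 1) / 2 := by nlinarith
      calc (n : ℝ) * (1 / (n.choose a : ℝ)) ≤ n * (1 / (n * (n - 1) / 2)) := by gcongr
        _ = 2 / (n - 1) := by
          have : (n : ℝ) - 1 ≠ 0 := by linarith
          field_simp
  rw [Finset.mul_sum]
  refine (Finset.sum_le_sum hterm).trans ?_
  rw [Finset.sum_add_distrib, Finset.sum_add_distrib, Finset.sum_const, Nat.card_Ico,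
    nsmul_eq_mul, Finset.sum_ite_eq', Finset.sum_ite_eq', Nat.cast_sub (by omega), Nat.cast_one,
    mul_div_cancel₀ _ (by linarith)]
  split_ifs <;> norm_num

theorem factorial_mul_factorial_mul_le {x y c : ℕ} (h : c ≤ (x + y).choose x) :
    x ! * y ! * c ≤ (x + y)! := by
  rw [← Nat.add_choose_mul_factorial_mul_factorial x y, mul_comm, mul_assoc, Nat.choose_symm_add.symm]
  exact Nat.mul_le_mul_right _ h

theorem sum_powerset_card_filter {ι : Type*} [DecidableEq ι] (S : Finset ι) (p : ι → Prop)
    [DecidablePred p]     (f : ℕ → ℕ → ℝ) :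
    ∑ A ∈ S.powerset, f (A.filter p).card (A.filter (fun x => ¬ p x)).card =
      ∑ a ∈ Finset.range ((S.filter p).card + 1),
        ∑ b ∈ Finset.range ((S.filter (fun x => ¬ p x)).card + 1),
          ((S.filter p).card.choose a : ℝ) *
            (((S.filter (fun x => ¬ p x)).card.choose b : ℝ) * f a b) := by
  have h1 : ∑ A ∈ S.powerset, f (A.filter p).card (A.filter (fun x => ¬ p x)).card =
      ∑ q ∈ (S.filter p).powerset ×ˢ (S.filter (fun x => ¬ p x)).powerset,
        f q.1.card q.2.card := by
    refine Finset.sum_nbij' (fun A => (A.filter p, A.filter (fun x => ¬ p x)))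
      (fun q => q.1 ∪ q.2) ?_ ?_ ?_ ?_ ?_
    · intro A hA
      rw [Finset.mem_powerset] at hA
      rw [Finset.mem_product, Finset.mem_powerset, Finset.mem_powerset]
      exact ⟨Finset.filter_subset_filter _ hA, Finset.filter_subset_filter _ hA⟩
    · intro q hq
      rw [Finset.mem_product, Finset.mem_powerset, Finset.mem_powerset] at hq
      rw [Finset.mem_powerset]
      exact Finset.union_subset (hq.1.trans (Finset.filter_subset _ _))
        (hq.2.trans (Finset.filter_subset _ _))
    · intro A _
      exact Finset.filter_union_filter_not_eq p A
    · rintro ⟨q1, q2⟩ hq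
      rw [Finset.mem_product, Finset.mem_powerset, Finset.mem_powerset] at hq
      have e1 : ∀ x ∈ q1, p x := fun x hx => (Finset.mem_filter.1 (hq.1 hx)).2
      have e2 : ∀ x ∈ q2, ¬ p x := fun x hx => (Finset.mem_filter.1 (hq.2 hx)).2
      ext x : 2
      · simp only [Finset.mem_filter, Finset.mem_union]
        have := e1 x; have := e2 x; tauto
      · simp only [Finset.mem_filter, Finset.mem_union]
        have := e1 x; have := e2 x; tauto
    · intro A _
      rfl
  rw [h1, Finset.sum_product]
  have h2 : ∀ x ∈ (S.filter p).powerset,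
      ∑ y ∈ (S.filter (fun x => ¬ p x)).powerset, f x.card y.card =
      (fun a => ∑ b ∈ Finset.range ((S.filter (fun x => ¬ p x)).card + 1),
        ((S.filter (fun x => ¬ p x)).card.choose b : ℝ) * f a b) x.card := by
    intro x _
    rw [Finset.sum_powerset_apply_card (fun b => f x.card b)]
    simp only [nsmul_eq_mul]
  rw [Finset.sum_congr rfl h2, Finset.sum_powerset_apply_card
    (fun a => ∑ b ∈ Finset.range ((S.filter (fun x => ¬ p x)).card + 1),
      ((S.filter (fun x => ¬ p x)).card.choose b : ℝ) * f a b)]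
  simp only [nsmul_eq_mul, Finset.mul_sum]

end Binomial

section EmapBounds

/-- An envelope for the growth of `totalWeight`: `9 ^ n`, frozen from `n = 36` on. -/
noncomputable def cappedPow (n : ℕ) : ℝ := 9 ^ min n 36

theorem cappedPow_zero : cappedPow 0 = 1 := by simp [cappedPow]

theorem cappedPow_pos (n : ℕ) : 0 < cappedPow n := by
  unfold cappedPow
  positivity

theorem cappedPow_mono {a b : ℕ} (h : a ≤ b) : cappedPow a ≤ cappedPow b := by
  unfold cappedPow
  exact pow_le_pow_right₀ (by norm_num) (by omega)

theorem cappedPow_le (n : ℕ) : cappedPow n ≤ 9 ^ 36 := by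
  unfold cappedPow
  exact pow_le_pow_right₀ (by norm_num) (by omega)

theorem cappedPow_recursion {n : ℕ} (hn : 1 ≤ n) :
    8 * ∑ b ∈ Finset.Ico 1 (n + 1), cappedPow (n - b) / n.choose b ≤ cappedPow n := by
  rw [Finset.sum_Ico_succ_top hn, Nat.sub_self, cappedPow_zero, Nat.choose_self, Nat.cast_one,
    div_one]
  have hle : ∑ b ∈ Finset.Ico 1 n, cappedPow (n - b) / n.choose b ≤
      cappedPow (n - 1) * ∑ b ∈ Finset.Ico 1 n, (1 / (n.choose b : ℝ)) := by
    rw [Finset.mul_sum]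
    refine Finset.sum_le_sum fun b hb => ?_
    rw [Finset.mem_Ico] at hb
    rw [mul_one_div]
    exact div_le_div_of_nonneg_right (cappedPow_mono (by omega)) (by positivity)
  have h1 := sum_inv_choose_le_one n
  have h4 := sum_inv_choose_le n
  set σ := ∑ b ∈ Finset.Ico 1 n, (1 / (n.choose b : ℝ)) with hσ
  have hσ0 : 0 ≤ σ := Finset.sum_nonneg fun _ _ => by positivity
  rcases le_or_gt n 36 with h | h
  · rcases hn.eq_or_lt with h' | h'
    · subst h'
      norm_num [cappedPow]
    have e1 : cappedPow n = 9 * cappedPow (n - 1) := by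
      unfold cappedPow
      rw [min_eq_left h, min_eq_left (by omega), ← _root_.pow_succ']
      congr 1
      omega
    have e2 : 9 ≤ cappedPow (n - 1) := by
      have := cappedPow_mono (show 1 ≤ n - 1 by omega)
      simpa [cappedPow] using this
    nlinarith
  · have e1 : cappedPow n = 9 ^ 36 := by rw [cappedPow, min_eq_right h.le]
    have e2 : cappedPow (n - 1) = 9 ^ 36 := by rw [cappedPow, min_eq_right (by omega)]
    have hn' : (37 : ℝ) ≤ n := by exact_mod_cast h
    have hσ1 : σ ≤ 4 / 37 := by nlinarith
    rw [e1]
    rw [e2] at hle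
    nlinarith

variable {ι : Type*} [DecidableEq ι]

theorem sum_sdiff_add_sum_nat {A S : Finset ι} (h : A ⊆ S) (v : ι → ℕ) :
    ∑ x ∈ A, v x + ∑ x ∈ S \ A, v x = ∑ x ∈ S, v x := by
  rw [add_comm, Finset.sum_sdiff h]

theorem card_add_two_mul_card_le_sum {ι : Type*} {S : Finset ι} {v : ι → ℕ} (hv : ∀ x ∈ S, 1 ≤ v x) :
    (S.filter (fun x => v x = 1)).card + 2 * (S.filter (fun x => ¬ v x = 1)).card ≤
      ∑ x ∈ S, v x := by
  rw [← Finset.sum_filter_add_sum_filter_not S (fun x => v x = 1) v]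
  refine Nat.add_le_add ?_ ?_
  · simpa using Finset.card_nsmul_le_sum (S.filter (fun x => v x = 1)) v 1
      fun x hx => hv x (Finset.mem_filter.1 hx).1
  · rw [mul_comm]
    simpa using Finset.card_nsmul_le_sum (S.filter (fun x => ¬ v x = 1)) v 2
      fun x hx => by
        have h1 := hv x (Finset.mem_filter.1 hx).1
        have h2 := (Finset.mem_filter.1 hx).2
        omega

theorem card_filter_sdiff {A S : Finset ι} (h : A ⊆ S) (p : ι → Prop)
    [DecidablePred p] :
    ((S \ A).filter p).card = (S.filter p).card - (A.filter p).card := by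
  have : (S \ A).filter p = S.filter p \ A.filter p := by
    ext x
    simp only [Finset.mem_filter, Finset.mem_sdiff]
    tauto
  rw [this, Finset.card_sdiff_of_subset (Finset.filter_subset_filter p h)]

theorem factorial_sum_mul_factorial_sum_le {A S : Finset ι} {v : ι → ℕ} (h : A ⊆ S)
    (hv : ∀ x ∈ S, 1 ≤ v x) :
    (∑ x ∈ A, v x)! * (∑ x ∈ S \ A, v x)! *
      ((S.filter (fun x => v x = 1)).card.choose (A.filter (fun x => v x = 1)).card *
        (S.filter (fun x => ¬ v x = 1)).card.choose (A.filter (fun x => ¬ v x = 1)).card ^ 2) ≤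
      (∑ x ∈ S, v x)! := by
  have hA := card_add_two_mul_card_le_sum (S := A) fun x hx => hv x (h hx)
  have hB := card_add_two_mul_card_le_sum (S := S \ A)
    fun x hx => hv x (Finset.mem_sdiff.1 hx).1
  have h1 := Finset.card_le_card (Finset.filter_subset_filter (fun x => v x = 1) h)
  have h2 := Finset.card_le_card (Finset.filter_subset_filter (fun x => ¬ v x = 1) h)
  rw [card_filter_sdiff h, card_filter_sdiff h] at hB
  have hc := choose_mul_choose_sq_le hA hB
  rw [Nat.add_sub_cancel' h1, Nat.add_sub_cancel' h2] at hc
  rw [← sum_sdiff_add_sum_nat h v]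
  exact factorial_mul_factorial_mul_le hc

theorem sum_geometric_le (w : ℕ) : ∑ a ∈ Finset.Ico 1 (w + 1), ((1 : ℝ) / 71) ^ a ≤ 1 / 70 := by
  have h : ∑ a ∈ Finset.Ico 1 (w + 1), ((1 : ℝ) / 71) ^ a = (1 - (1 / 71) ^ w) / 70 := by
    induction w with
    | zero => simp
    | succ w ih =>
      rw [Finset.sum_Ico_succ_top (by omega), ih, pow_succ]
      ring
  rw [h]
  have : (0 : ℝ) ≤ (1 / 71) ^ w := by positivity
  linarith

variable [Fintype ι]

theorem totalWeight_le (v : ι → ℕ) (S : Finset ι) (hv : ∀ x ∈ S, 1 ≤ v x) :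
    totalWeight v S ≤ 71 ^ (S.filter (fun x => v x = 1)).card *
      cappedPow (S.filter (fun x => ¬ v x = 1)).card * ((∑ x ∈ S, v x)! : ℝ) := by
  induction S using Finset.strongInduction with
  | H S ih =>
  rcases S.eq_empty_or_nonempty with rfl | hS
  · simp [totalWeight_empty, cappedPow]
  set w := (S.filter (fun x => v x = 1)).card with hw
  set n := (S.filter (fun x => ¬ v x = 1)).card with hn
  have hwn : w + n = S.card := Finset.card_filter_add_card_filter_not _
  have hrec : totalWeight v S ≤ ∑ A ∈ S.powerset.filter (fun A => A.Nonempty),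
      7 * ((∑ x ∈ A, v x)! : ℝ) * totalWeight v (S \ A) := by
    refine sum_partitionWeight_le v S _ _ fun P hP => ?_
    rw [Finset.mem_filter] at hP
    refine ⟨hP.2, ?_, fun A hA => ?_⟩
    · rw [Finset.nonempty_iff_ne_empty]
      rintro rfl
      have := hP.2.biUnion_eq
      rw [Finset.biUnion_empty] at this
      exact hS.ne_empty this.symm
    · rw [Finset.mem_filter, Finset.mem_powerset]
      exact ⟨(hP.2.1 A hA).1, Finset.nonempty_iff_ne_empty.2 (hP.2.1 A hA).2⟩
  set f : ℕ → ℕ → ℝ := fun a b => if a = 0 ∧ b = 0 then 0 else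
    7 * (71 ^ w * (1 / 71) ^ a * cappedPow (n - b)) * ((∑ x ∈ S, v x)! : ℝ) /
      (w.choose a * n.choose b ^ 2) with hf
  have hterm : ∀ A ∈ S.powerset.filter (fun A => A.Nonempty),
      7 * ((∑ x ∈ A, v x)! : ℝ) * totalWeight v (S \ A) ≤
        f (A.filter (fun x => v x = 1)).card (A.filter (fun x => ¬ v x = 1)).card := by
    intro A hA
    rw [Finset.mem_filter, Finset.mem_powerset] at hA
    obtain ⟨hAS, hA0⟩ := hA
    have hcard : (A.filter (fun x => v x = 1)).card + (A.filter (fun x => ¬ v x = 1)).card =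
      A.card := Finset.card_filter_add_card_filter_not _
    have hpos := Finset.card_pos.2 hA0
    have h1 : (A.filter (fun x => v x = 1)).card ≤ w :=
      Finset.card_le_card (Finset.filter_subset_filter (fun x => v x = 1) hAS)
    have h2 : (A.filter (fun x => ¬ v x = 1)).card ≤ n :=
      Finset.card_le_card (Finset.filter_subset_filter (fun x => ¬ v x = 1) hAS)
    have hih := ih (S \ A) (Finset.sdiff_ssubset hAS hA0)
      fun x hx => hv x (Finset.mem_sdiff.1 hx).1
    rw [card_filter_sdiff hAS, card_filter_sdiff hAS, ← hw, ← hn] at hih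
    have hfac := factorial_sum_mul_factorial_sum_le hAS hv
    rw [← hw, ← hn] at hfac
    set a := (A.filter (fun x => v x = 1)).card
    set b := (A.filter (fun x => ¬ v x = 1)).card
    have hfac' : ((∑ x ∈ A, v x)! : ℝ) * ((∑ x ∈ S \ A, v x)! : ℝ) *
      (w.choose a * n.choose b ^ 2) ≤ ((∑ x ∈ S, v x)! : ℝ) := by exact_mod_cast hfac
    have hc : (0 : ℝ) < w.choose a * n.choose b ^ 2 := by
      have := Nat.choose_pos h1
      have := Nat.choose_pos h2
      positivity
    have h71 : (71 : ℝ) ^ (w - a) = 71 ^ w * (1 / 71) ^ a := by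
      rw [pow_sub₀ _ (by norm_num) h1, one_div, inv_pow]
    rw [h71] at hih
    simp only [hf]
    rw [if_neg (by omega), le_div_iff₀ hc]
    have hk := cappedPow_pos (n - b)
    calc 7 * ((∑ x ∈ A, v x)! : ℝ) * totalWeight v (S \ A) * (w.choose a * n.choose b ^ 2)
        ≤ 7 * ((∑ x ∈ A, v x)! : ℝ) * (71 ^ w * (1 / 71) ^ a * cappedPow (n - b) *
          ((∑ x ∈ S \ A, v x)! : ℝ)) * (w.choose a * n.choose b ^ 2) := by gcongr
      _ = 7 * (71 ^ w * (1 / 71) ^ a * cappedPow (n - b)) * (((∑ x ∈ A, v x)! : ℝ) *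
          ((∑ x ∈ S \ A, v x)! : ℝ) * (w.choose a * n.choose b ^ 2)) := by ring
      _ ≤ _ := by gcongr
  have hf0 : ∀ a b, 0 ≤ f a b := by
    intro a b
    simp only [hf]
    have := cappedPow_pos (n - b)
    split_ifs <;> positivity
  refine hrec.trans ((Finset.sum_le_sum hterm).trans ?_)
  refine (Finset.sum_le_sum_of_subset_of_nonneg (Finset.filter_subset _ _)
    fun _ _ _ => hf0 _ _).trans ?_
  rw [sum_powerset_card_filter S (fun x => v x = 1) f, ← hw, ← hn]
  set K : ℝ := 71 ^ w * ((∑ x ∈ S, v x)! : ℝ) with hK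
  have hK0 : 0 ≤ K := by positivity
  have hsimp : ∀ a ∈ Finset.range (w + 1), ∀ b ∈ Finset.range (n + 1),
      (w.choose a : ℝ) * ((n.choose b : ℝ) * f a b) = if a = 0 ∧ b = 0 then 0 else
        7 * K * ((1 / 71) ^ a * (cappedPow (n - b) / n.choose b)) := by
    intro a ha b hb
    rw [Finset.mem_range] at ha hb
    simp only [hf]
    split_ifs with h
    · simp
    · have h1 : (w.choose a : ℝ) ≠ 0 := by exact_mod_cast (Nat.choose_pos (by omega)).ne'
      have h2 : (n.choose b : ℝ) ≠ 0 := by exact_mod_cast (Nat.choose_pos (by omega)).ne'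
      rw [hK]
      field_simp
  rw [Finset.sum_congr rfl fun a ha => Finset.sum_congr rfl (hsimp a ha)]
  have hinner : ∀ a, ∑ b ∈ Finset.range (n + 1), (if a = 0 ∧ b = 0 then (0 : ℝ) else
        7 * K * ((1 / 71) ^ a * (cappedPow (n - b) / n.choose b))) =
      (if a = 0 then 0 else 7 * K * (1 / 71) ^ a * cappedPow n) +
        7 * K * (1 / 71) ^ a * ∑ b ∈ Finset.Ico 1 (n + 1), cappedPow (n - b) / n.choose b := by
    intro a
    rw [Finset.range_eq_Ico, Finset.sum_eq_sum_Ico_succ_bot (by omega)]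
    congr 1
    · by_cases h : a = 0
      · simp [h]
      · simp [h, mul_assoc]
    · rw [Finset.mul_sum]
      refine Finset.sum_congr rfl fun b hb => ?_
      rw [Finset.mem_Ico] at hb
      rw [if_neg (by omega)]
      ring
  rw [Finset.sum_congr rfl fun a _ => hinner a, Finset.sum_add_distrib, ← Finset.sum_mul,
    ← Finset.mul_sum, Finset.range_eq_Ico, Finset.sum_eq_sum_Ico_succ_bot w.succ_pos,
    Finset.sum_eq_sum_Ico_succ_bot w.succ_pos, if_pos rfl, zero_add, zero_add, _root_.pow_zero]
  have hone : ∑ a ∈ Finset.Ico 1 (w + 1), (if a = 0 then (0 : ℝ) else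
      7 * K * (1 / 71) ^ a * cappedPow n) =
      7 * K * cappedPow n * ∑ a ∈ Finset.Ico 1 (w + 1), ((1 : ℝ) / 71) ^ a := by
    rw [Finset.mul_sum]
    refine Finset.sum_congr rfl fun a ha => ?_
    rw [Finset.mem_Ico] at ha
    rw [if_neg (by omega)]
    ring
  rw [hone]
  have hgeo := sum_geometric_le w
  have hgeo0 : 0 ≤ ∑ a ∈ Finset.Ico 1 (w + 1), ((1 : ℝ) / 71) ^ a :=
    Finset.sum_nonneg fun _ _ => by positivity
  set G := ∑ a ∈ Finset.Ico 1 (w + 1), ((1 : ℝ) / 71) ^ a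
  set R := ∑ b ∈ Finset.Ico 1 (n + 1), cappedPow (n - b) / n.choose b with hR
  have hR0 : 0 ≤ R := Finset.sum_nonneg fun b _ => by
    have := cappedPow_pos (n - b)
    positivity
  have hR8 : 8 * R ≤ cappedPow n := by
    rcases Nat.eq_zero_or_pos n with h | h
    · rw [hR, h]
      simp [cappedPow]
    · exact cappedPow_recursion h
  have hκ := cappedPow_pos n
  have hfin : 7 * cappedPow n * G + 7 * (1 + G) * R ≤ cappedPow n := by nlinarith
  calc 7 * K * cappedPow n * G + 7 * K * (1 + G) * R
      = K * (7 * cappedPow n * G + 7 * (1 + G) * R) := by ring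
    _ ≤ K * cappedPow n := by gcongr
    _ = _ := by rw [hK]; ring

theorem abs_innerSingle_le (v : ι → ℕ) (S : Finset ι) (hv : ∀ x ∈ S, 1 ≤ v x) :
    |innerSingle S v| ≤ 2 * 9 ^ 36 * 71 ^ (S.filter (fun x => v x = 1)).card *
      ((∑ x ∈ S, v x)! : ℝ) := by
  have hE : |Emap S v| ≤ totalWeight v S := by
    refine (abs_Emap_le_sum S v).trans ?_
    refine Finset.sum_le_sum_of_subset_of_nonneg ?_ fun _ _ _ => partitionWeight_nonneg _ _
    intro P hP
    rw [Finset.mem_filter] at hP ⊢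
    exact ⟨hP.1, hP.2.1⟩
  have hz := abs_zed_le ((∑ x ∈ S, v x : ℤ) - S.card + 2)
  have hT := totalWeight_le v S hv
  have hκ := cappedPow_le (S.filter (fun x => ¬ v x = 1)).card
  have hκ0 := cappedPow_pos (S.filter (fun x => ¬ v x = 1)).card
  have h71 : (1 : ℝ) ≤ 71 ^ (S.filter (fun x => v x = 1)).card := one_le_pow₀ (by norm_num)
  set p : ℝ := 71 ^ (S.filter (fun x => v x = 1)).card
  have hfac : (0 : ℝ) < ((∑ x ∈ S, v x)! : ℝ) := by positivity
  set F : ℝ := ((∑ x ∈ S, v x)! : ℝ)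
  calc |innerSingle S v| ≤ F * (7 / 3) + p * 9 ^ 36 * F := by
        unfold innerSingle
        refine (abs_add_le _ _).trans (add_le_add ?_ (hE.trans (hT.trans ?_)))
        · rw [abs_mul, Nat.abs_cast]
          gcongr
        · gcongr
    _ ≤ p * 9 ^ 36 * F + p * 9 ^ 36 * F := by
        have h73 : 7 / 3 ≤ p * 9 ^ 36 := by nlinarith
        nlinarith [mul_le_mul_of_nonneg_right h73 hfac.le]
    _ = _ := by ring

theorem choose_mul_le_mul_choose {a b c d : ℕ} (ha : 1 ≤ a) (hb : 1 ≤ b) (hac : a ≤ c)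
    (hbd : b ≤ d) :
    (c + d) * (a + b).choose a ≤ (a + b) * (c + d).choose c := by
  have hstep : ∀ x y : ℕ, 1 ≤ y →
      (x + 1 + y) * (x + y).choose x ≤ (x + y) * (x + 1 + y).choose (x + 1) := by
    intro x y hy
    have h := Nat.add_one_mul_choose_eq (x + y) x
    have e : x + 1 + y = x + y + 1 := by ring
    rw [e, h, mul_comm]
    exact Nat.mul_le_mul_right _ (by omega)
  have hleft : ∀ b, 1 ≤ b → ∀ c, a ≤ c →
      (c + b) * (a + b).choose a ≤ (a + b) * (c + b).choose c := by
    intro b hb c hac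
    induction c, hac using Nat.le_induction with
    | base => exact le_rfl
    | succ c hc ih =>
      have hs := hstep c b hb
      have hcb : 0 < c + b := by omega
      refine _root_.le_of_mul_le_mul_left (a := c + b) ?_ hcb
      calc (c + b) * ((c + 1 + b) * (a + b).choose a)
          = (c + 1 + b) * ((c + b) * (a + b).choose a) := by ring
        _ ≤ (c + 1 + b) * ((a + b) * (c + b).choose c) := Nat.mul_le_mul_left _ ih
        _ = (a + b) * ((c + 1 + b) * (c + b).choose c) := by ring
        _ ≤ (a + b) * ((c + b) * (c + 1 + b).choose (c + 1)) := Nat.mul_le_mul_left _ hs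
        _ = _ := by ring
  have hright : ∀ d, b ≤ d →
      (c + d) * (c + b).choose c ≤ (c + b) * (c + d).choose c := by
    intro d hbd
    induction d, hbd using Nat.le_induction with
    | base => exact le_rfl
    | succ d hd ih =>
      have hs := hstep d c (by omega)
      have e1 : (c + d).choose c = (d + c).choose d := by
        rw [Nat.choose_symm_add, add_comm]
      have e2 : (c + (d + 1)).choose c = (d + 1 + c).choose (d + 1) := by
        rw [Nat.choose_symm_add, add_comm]
      rw [e2]
      rw [e1] at ih
      have hcb : 0 < d + c := by omega
      refine _root_.le_of_mul_le_mul_left (a := d + c) ?_ hcb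
      calc (d + c) * ((c + (d + 1)) * (c + b).choose c)
          = (d + 1 + c) * ((c + d) * (c + b).choose c) := by ring
        _ ≤ (d + 1 + c) * ((c + b) * (d + c).choose d) := Nat.mul_le_mul_left _ ih
        _ = (c + b) * ((d + 1 + c) * (d + c).choose d) := by ring
        _ ≤ (c + b) * ((d + c) * (d + 1 + c).choose (d + 1)) := Nat.mul_le_mul_left _ hs
        _ = _ := by ring
  have hcb : 0 < c + b := by omega
  refine _root_.le_of_mul_le_mul_left (a := c + b) ?_ hcb
  calc (c + b) * ((c + d) * (a + b).choose a) = (c + d) * ((c + b) * (a + b).choose a) := by ring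
    _ ≤ (c + d) * ((a + b) * (c + b).choose c) := Nat.mul_le_mul_left _ (hleft b hb c hac)
    _ = (a + b) * ((c + d) * (c + b).choose c) := by ring
    _ ≤ (a + b) * ((c + b) * (c + d).choose c) := Nat.mul_le_mul_left _ (hright d hbd)
    _ = _ := by ring

theorem abs_Emap_le_of_two_le (v : ι → ℕ) (S : Finset ι) (hv : ∀ x ∈ S, 2 ≤ v x) :
    |Emap S v| ≤ 56 * 9 ^ 36 * (((∑ x ∈ S, v x) - 1)! : ℝ) := by
  set N := ∑ x ∈ S, v x with hN
  set n := S.card with hn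
  have hrec : |Emap S v| ≤ ∑ A ∈ S.powerset.filter (fun A => A.Nonempty ∧ A ≠ S),
      7 * ((∑ x ∈ A, v x)! : ℝ) * totalWeight v (S \ A) := by
    refine (abs_Emap_le_sum S v).trans (sum_partitionWeight_le v S _ _ fun P hP => ?_)
    rw [Finset.mem_filter] at hP
    refine ⟨hP.2.1, Finset.card_pos.1 (by omega), fun A hA => ?_⟩
    rw [Finset.mem_filter, Finset.mem_powerset]
    refine ⟨(hP.2.1.1 A hA).1, Finset.nonempty_iff_ne_empty.2 (hP.2.1.1 A hA).2, ?_⟩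
    rintro rfl
    have := hP.2.1.eq_singleton hA
    rw [this, Finset.card_singleton] at hP
    omega
  set f : ℕ → ℝ := fun a => if 1 ≤ a ∧ a < n then
    7 * 9 ^ 36 * ((N - 1)! : ℝ) * (2 * n) / n.choose a ^ 2 else 0 with hf
  have hterm : ∀ A ∈ S.powerset.filter (fun A => A.Nonempty ∧ A ≠ S),
      7 * ((∑ x ∈ A, v x)! : ℝ) * totalWeight v (S \ A) ≤ f A.card := by
    intro A hA
    rw [Finset.mem_filter, Finset.mem_powerset] at hA
    obtain ⟨hAS, hA0, hne⟩ := hA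
    have hc1 := Finset.card_pos.2 hA0
    have hc2 : A.card < n := Finset.card_lt_card (hAS.ssubset_of_ne hne)
    have hcs : (S \ A).card = n - A.card := Finset.card_sdiff_of_subset hAS
    have hxa : 2 * A.card ≤ ∑ x ∈ A, v x := by
      rw [mul_comm]
      simpa using Finset.card_nsmul_le_sum A v 2 fun x hx => hv x (hAS hx)
    have hxb : 2 * (n - A.card) ≤ ∑ x ∈ S \ A, v x := by
      rw [← hcs, mul_comm]
      simpa using Finset.card_nsmul_le_sum (S \ A) v 2
        fun x hx => hv x (Finset.mem_sdiff.1 hx).1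
    have hT : totalWeight v (S \ A) ≤ 9 ^ 36 * ((∑ x ∈ S \ A, v x)! : ℝ) := by
      refine (totalWeight_le v (S \ A) fun x hx =>
        le_trans (by norm_num) (hv x (Finset.mem_sdiff.1 hx).1)).trans ?_
      have h0 : (S \ A).filter (fun x => v x = 1) = ∅ := by
        refine Finset.filter_eq_empty_iff.2 fun x hx => ?_
        have := hv x (Finset.mem_sdiff.1 hx).1
        omega
      rw [h0, Finset.card_empty, pow_zero, one_mul]
      gcongr
      exact cappedPow_le _
    have hsum : ∑ x ∈ A, v x + ∑ x ∈ S \ A, v x = N := sum_sdiff_add_sum_nat hAS v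
    set x := ∑ x ∈ A, v x
    set y := ∑ x ∈ S \ A, v x
    set a := A.card
    have hch := choose_mul_le_mul_choose (a := 2 * a) (b := 2 * (n - a)) (by omega) (by omega)
      hxa hxb
    have hsq := choose_mul_choose_sq_le (a := 0) (b := 0) (c := a) (d := n - a)
      (x := 2 * a) (y := 2 * (n - a)) (by omega) (by omega)
    simp only [zero_add, Nat.choose_self, one_mul] at hsq
    rw [Nat.add_sub_cancel' hc2.le] at hsq
    have e2 : 2 * a + 2 * (n - a) = 2 * n := by omega
    rw [hsum, e2] at hch
    rw [e2] at hsq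
    have hfac : x ! * y ! * N.choose x = N ! := by
      rw [← hsum, mul_comm, ← mul_assoc, Nat.choose_symm_add, Nat.add_choose_mul_factorial_mul_factorial]
    have hN1 : 0 < N := by omega
    have hNf : N * (N - 1)! = N ! := Nat.mul_factorial_pred hN1.ne'
    have hkey : x ! * y ! * n.choose a ^ 2 ≤ (2 * n) * (N - 1)! := by
      refine _root_.le_of_mul_le_mul_left (a := N) ?_ hN1
      calc N * (x ! * y ! * n.choose a ^ 2) = x ! * y ! * (N * n.choose a ^ 2) := by ring
        _ ≤ x ! * y ! * (2 * n * N.choose x) :=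
          Nat.mul_le_mul_left _ ((Nat.mul_le_mul_left _ hsq).trans hch)
        _ = 2 * n * (x ! * y ! * N.choose x) := by ring
        _ = N * (2 * n * (N - 1)!) := by rw [hfac, ← hNf]; ring
    have hkey' : (x ! : ℝ) * y ! * n.choose a ^ 2 ≤ (2 * n) * (N - 1)! := by exact_mod_cast hkey
    have hcpos : (0 : ℝ) < n.choose a ^ 2 := by
      have := Nat.choose_pos hc2.le
      positivity
    simp only [hf]
    rw [if_pos ⟨hc1, hc2⟩, le_div_iff₀ hcpos]
    calc 7 * (x ! : ℝ) * totalWeight v (S \ A) * n.choose a ^ 2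
        ≤ 7 * (x ! : ℝ) * (9 ^ 36 * (y ! : ℝ)) * n.choose a ^ 2 := by gcongr
      _ = 7 * 9 ^ 36 * ((x ! : ℝ) * y ! * n.choose a ^ 2) := by ring
      _ ≤ 7 * 9 ^ 36 * ((2 * n) * (N - 1)!) := by gcongr
      _ = _ := by ring
  have hf0 : ∀ a, 0 ≤ f a := by
    intro a
    simp only [hf]
    split_ifs <;> positivity
  refine hrec.trans ((Finset.sum_le_sum hterm).trans ?_)
  refine (Finset.sum_le_sum_of_subset_of_nonneg (Finset.filter_subset _ _)
    fun _ _ _ => hf0 _).trans ?_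
  rw [Finset.sum_powerset_apply_card, ← hn]
  simp only [hf, nsmul_eq_mul, mul_ite, mul_zero]
  rw [← Finset.sum_filter]
  have hset : (Finset.range (n + 1)).filter (fun a => 1 ≤ a ∧ a < n) = Finset.Ico 1 n := by
    ext a
    simp only [Finset.mem_filter, Finset.mem_range, Finset.mem_Ico]
    omega
  rw [hset]
  calc ∑ a ∈ Finset.Ico 1 n, (n.choose a : ℝ) *
        (7 * 9 ^ 36 * ((N - 1)! : ℝ) * (2 * n) / n.choose a ^ 2)
      = 14 * 9 ^ 36 * ((N - 1)! : ℝ) * (n * ∑ a ∈ Finset.Ico 1 n, (1 / (n.choose a : ℝ))) := by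
        rw [Finset.mul_sum, Finset.mul_sum]
        refine Finset.sum_congr rfl fun a ha => ?_
        rw [Finset.mem_Ico] at ha
        have h2 : (n.choose a : ℝ) ≠ 0 := by exact_mod_cast (Nat.choose_pos (by omega)).ne'
        field_simp
        ring
    _ ≤ 14 * 9 ^ 36 * ((N - 1)! : ℝ) * 4 := by
        gcongr
        exact sum_inv_choose_le n
    _ = _ := by ring

end EmapBounds

section Insertion

theorem ascFactorial_le_ascFactorial {m n : ℕ} (h : m ≤ n) (a : ℕ) :
    m.ascFactorial a ≤ n.ascFactorial a := by
  induction a with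
  | zero => simp
  | succ a ih =>
    rw [Nat.ascFactorial_succ, Nat.ascFactorial_succ]
    exact Nat.mul_le_mul (by omega) ih

theorem ascFactorial_add_le (a x y : ℕ) :
    (x + 2).ascFactorial a + (y + 2).ascFactorial a ≤
      (x + y + 2).ascFactorial a + (2 : ℕ).ascFactorial a := by
  induction a with
  | zero => simp
  | succ a ih =>
    have hx : (x + 2).ascFactorial a ≤ (x + y + 2).ascFactorial a :=
      ascFactorial_le_ascFactorial (by omega) a
    have hy : (y + 2).ascFactorial a ≤ (x + y + 2).ascFactorial a :=
      ascFactorial_le_ascFactorial (by omega) a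
    simp only [Nat.ascFactorial_succ]
    nlinarith [Nat.mul_le_mul_left x hx, Nat.mul_le_mul_left y hy,
      Nat.mul_le_mul_left (2 + a) ih]

theorem sum_ascFactorial_le {κ : Type*} (B : Finset κ) (hB : B.Nonempty) (z : κ → ℕ) (a : ℕ) :
    ∑ b ∈ B, (z b + 2).ascFactorial a ≤
      (∑ b ∈ B, z b + 2).ascFactorial a + (B.card - 1) * (2 : ℕ).ascFactorial a := by
  induction hB using Finset.Nonempty.cons_induction with
  | singleton b => simp
  | cons b B hb hB ih =>
    rw [Finset.sum_cons, Finset.sum_cons, Finset.card_cons, Nat.add_sub_cancel]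
    have h := ascFactorial_add_le a (z b) (∑ b ∈ B, z b)
    obtain ⟨c, hc⟩ := Nat.exists_eq_succ_of_ne_zero (Finset.card_pos.2 hB).ne'
    rw [hc, Nat.succ_sub_one] at ih
    rw [hc, Nat.succ_mul]
    omega

theorem two_ascFactorial_mul_le (Z : ℕ) {a : ℕ} (ha : 2 ≤ a) :
    (2 : ℕ).ascFactorial a * ((Z + 2) * (Z + 3)) ≤ 6 * (Z + 2).ascFactorial a := by
  induction a, ha using Nat.le_induction with
  | base =>
    simp only [Nat.ascFactorial_succ, Nat.ascFactorial_zero]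
    nlinarith
  | succ a ha ih =>
    rw [Nat.ascFactorial_succ, Nat.ascFactorial_succ]
    calc (2 + a) * (2 : ℕ).ascFactorial a * ((Z + 2) * (Z + 3))
        = (2 + a) * ((2 : ℕ).ascFactorial a * ((Z + 2) * (Z + 3))) := by ring
      _ ≤ (Z + 2 + a) * (6 * (Z + 2).ascFactorial a) := Nat.mul_le_mul (by omega) ih
      _ = _ := by ring

variable {ι : Type*} [DecidableEq ι] [Fintype ι]

/-- The sum, over all ways to attach the elements of `Q` to elements of `B`, of the product of
the factorials of the resulting total values, the element `b` of `B` starting with value `c b`. -/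
noncomputable def attachSum (v : ι → ℕ) (B : Finset ι) (c : ι → ℕ) (Q : Finset ι) : ℝ :=
  ∑ f ∈ Fintype.piFinset (fun x => if x ∈ Q then B else {x}),
    ∏ b ∈ B, ((c b + ∑ x ∈ Q, if f x = b then v x else 0)! : ℝ)

theorem attachSum_empty (v : ι → ℕ) (B : Finset ι) (c : ι → ℕ) :
    attachSum v B c ∅ = ∏ b ∈ B, ((c b)! : ℝ) := by
  simp [attachSum]

theorem attachSum_insert (v : ι → ℕ) (B : Finset ι) (c : ι → ℕ) {Q : Finset ι} {q : ι}
    (hq : q ∉ Q) :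
    attachSum v B c (insert q Q) =
      ∑ b₀ ∈ B, attachSum v B (fun b => c b + if b₀ = b then v q else 0) Q := by
  unfold attachSum
  rw [← Finset.sum_product']
  symm
  refine Finset.sum_nbij' (fun p => Function.update p.2 q p.1)
    (fun f => (f q, Function.update f q q)) ?_ ?_ ?_ ?_ ?_
  · rintro ⟨b₀, f⟩ h
    simp only [Finset.mem_product, Fintype.mem_piFinset] at h ⊢
    intro x
    by_cases hx : x = q
    · subst hx
      simpa using h.1
    · have := h.2 x
      simpa [hx] using this
  · intro f h
    simp only [Finset.mem_product, Fintype.mem_piFinset] at h ⊢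
    refine ⟨by simpa using h q, fun x => ?_⟩
    by_cases hx : x = q
    · subst hx
      simp [hq]
    · have := h x
      simpa [hx] using this
  · rintro ⟨b₀, f⟩ h
    simp only [Finset.mem_product, Fintype.mem_piFinset] at h
    have hfq := h.2 q
    rw [if_neg hq, Finset.mem_singleton] at hfq
    simp [Function.update_eq_self_iff, hfq]
  · intro f h
    simp
  · rintro ⟨b₀, f⟩ h
    refine Finset.prod_congr rfl fun b _ => ?_
    rw [Finset.sum_insert hq, Function.update_self]
    have : ∑ x ∈ Q, (if Function.update f q b₀ x = b then v x else 0) =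
        ∑ x ∈ Q, if f x = b then v x else 0 := by
      refine Finset.sum_congr rfl fun x hx => ?_
      rw [Function.update_of_ne (ne_of_mem_of_not_mem hx hq)]
    rw [this, add_assoc]

theorem sum_prod_factorial_le {κ : Type*} [DecidableEq κ] {B : Finset κ} (hB : B.Nonempty)
    {c : κ → ℕ} (hc : ∀ b ∈ B, 1 ≤ c b) (a : ℕ) :
    ∑ b₀ ∈ B, ∏ b ∈ B, ((c b + if b₀ = b then a else 0)! : ℝ) ≤
      (∏ b ∈ B, ((c b)! : ℝ)) * (((∑ b ∈ B, (c b - 1) + 2).ascFactorial a : ℝ) +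
        ((B.card - 1 : ℕ) : ℝ) * ((2 : ℕ).ascFactorial a : ℝ)) := by
  have hterm : ∀ b₀ ∈ B, ∏ b ∈ B, ((c b + if b₀ = b then a else 0)! : ℝ) =
      (∏ b ∈ B, ((c b)! : ℝ)) * (((c b₀ - 1) + 2).ascFactorial a : ℝ) := by
    intro b₀ hb₀
    have hfac : ∀ b ∈ B, ((c b + if b₀ = b then a else 0)! : ℝ) =
        ((c b)! : ℝ) * (if b₀ = b then ((c b + 1).ascFactorial a : ℝ) else 1) := by
      intro b _
      split_ifs
      · rw [← Nat.factorial_mul_ascFactorial]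
        push_cast
        rfl
      · simp
    rw [Finset.prod_congr rfl hfac, Finset.prod_mul_distrib, Finset.prod_ite_eq, if_pos hb₀]
    have := hc b₀ hb₀
    rw [show c b₀ - 1 + 2 = c b₀ + 1 by omega]
  rw [Finset.sum_congr rfl hterm, ← Finset.mul_sum]
  refine mul_le_mul_of_nonneg_left ?_ (by positivity)
  exact_mod_cast sum_ascFactorial_le B hB (fun b => c b - 1) a

theorem attachSum_le {v : ι → ℕ} {B : Finset ι} {r : ℕ} (hB : B.card = r + 1) {Q : Finset ι}
    (hv : ∀ x ∈ Q, 1 ≤ v x) {c : ι → ℕ} (hc : ∀ b ∈ B, 1 ≤ c b) :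
    attachSum v B c Q ≤ (∏ b ∈ B, ((c b)! : ℝ)) *
      (((∑ b ∈ B, (c b - 1) + 1 + ∑ x ∈ Q, v x)! : ℝ) / ((∑ b ∈ B, (c b - 1) + 1)! : ℝ)) *
      (Real.exp (6 * r / ((∑ b ∈ B, (c b - 1) : ℕ) + 2)) *
        ∏ i ∈ Finset.range (Q.filter (fun x => v x = 1)).card,
          (1 + 2 * r / (((∑ b ∈ B, (c b - 1) : ℕ) : ℝ) + 2 + i))) := by
  have hBne : B.Nonempty := Finset.card_pos.1 (by omega)
  have main : ∀ N : ℕ, ∀ Q : Finset ι, Q.card = N → (∀ x ∈ Q, 1 ≤ v x) → ∀ c : ι → ℕ,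
      (∀ b ∈ B, 1 ≤ c b) → attachSum v B c Q ≤ (∏ b ∈ B, ((c b)! : ℝ)) *
      (((∑ b ∈ B, (c b - 1) + 1 + ∑ x ∈ Q, v x)! : ℝ) / ((∑ b ∈ B, (c b - 1) + 1)! : ℝ)) *
      (Real.exp (6 * r / ((∑ b ∈ B, (c b - 1) : ℕ) + 2)) *
        ∏ i ∈ Finset.range (Q.filter (fun x => v x = 1)).card,
          (1 + 2 * r / (((∑ b ∈ B, (c b - 1) : ℕ) : ℝ) + 2 + i))) := by
    intro N
    induction N with
    | zero =>
      intro Q hQ _ c _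
      rw [Finset.card_eq_zero] at hQ
      subst hQ
      rw [attachSum_empty, Finset.sum_empty, add_zero, div_self (by positivity), mul_one,
        Finset.filter_empty, Finset.card_empty, Finset.range_zero, Finset.prod_empty, mul_one]
      refine le_mul_of_one_le_right (by positivity) ?_
      rw [Real.one_le_exp_iff]
      positivity
    | succ N ih =>
      intro Q hQ hv c hc
      obtain ⟨q, hqQ, hq⟩ : ∃ q ∈ Q, v q = 1 ∨ (Q.filter (fun x => v x = 1)) = ∅ := by
        rcases (Q.filter (fun x => v x = 1)).eq_empty_or_nonempty with h | ⟨q, hq⟩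
        · obtain ⟨q, hq⟩ := Finset.card_pos.1 (show 0 < Q.card by omega)
          exact ⟨q, hq, Or.inr h⟩
        · rw [Finset.mem_filter] at hq
          exact ⟨q, hq.1, Or.inl hq.2⟩
      set Z := ∑ b ∈ B, (c b - 1) with hZ
      set a := v q with ha
      have hv' : ∀ x ∈ Q.erase q, 1 ≤ v x := fun x hx => hv x (Finset.mem_of_mem_erase hx)
      have hsumQ : ∑ x ∈ Q, v x = a + ∑ x ∈ Q.erase q, v x := (Finset.add_sum_erase Q v hqQ).symm
      set V := ∑ x ∈ Q.erase q, v x with hV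
      have ha1 : 1 ≤ a := hv q hqQ
      have hcsum : ∀ b₀ ∈ B, ∑ b ∈ B, ((c b + if b₀ = b then a else 0) - 1) = Z + a := by
        intro b₀ hb₀
        have : ∀ b ∈ B, (c b + if b₀ = b then a else 0) - 1 =
            (c b - 1) + if b₀ = b then a else 0 := by
          intro b hb
          have := hc b hb
          omega
        rw [Finset.sum_congr rfl this, Finset.sum_add_distrib, Finset.sum_ite_eq, if_pos hb₀]
      have hstep : attachSum v B c Q ≤ (∏ b ∈ B, ((c b)! : ℝ)) *
          (((Z + 2).ascFactorial a : ℝ) + (r : ℝ) * ((2 : ℕ).ascFactorial a : ℝ)) *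
          (((Z + a + 1 + V)! : ℝ) / ((Z + a + 1)! : ℝ) *
            (Real.exp (6 * r / ((Z + a : ℕ) + 2)) *
              ∏ i ∈ Finset.range ((Q.erase q).filter (fun x => v x = 1)).card,
                (1 + 2 * r / (((Z + a : ℕ) : ℝ) + 2 + i)))) := by
        conv_lhs => rw [← Finset.insert_erase hqQ]
        rw [attachSum_insert v B c (Finset.notMem_erase q Q)]
        have h2 := sum_prod_factorial_le hBne hc a
        rw [hB, Nat.add_sub_cancel, ← hZ] at h2
        refine le_trans ?_ (mul_le_mul_of_nonneg_right h2 (by positivity))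
        rw [Finset.sum_mul]
        refine Finset.sum_le_sum fun b₀ hb₀ => ?_
        have h3 := ih (Q.erase q) (by rw [Finset.card_erase_of_mem hqQ]; omega) hv'
          (fun b => c b + if b₀ = b then a else 0)
          fun b hb => (hc b hb).trans (Nat.le_add_right _ _)
        simp only [hcsum b₀ hb₀, ← hV] at h3
        refine h3.trans (le_of_eq ?_)
        ring
      refine hstep.trans ?_
      have hZa : ((Z + 1)! : ℝ) * ((Z + 2).ascFactorial a : ℝ) = ((Z + a + 1)! : ℝ) := by
        have := Nat.factorial_mul_ascFactorial (Z + 1) a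
        rw [show Z + 1 + a = Z + a + 1 by ring] at this
        exact_mod_cast this
      have hZ1 : (0 : ℝ) < ((Z + 1)! : ℝ) := by positivity
      have hA : (0 : ℝ) < ((Z + 2).ascFactorial a : ℝ) := by
        have : ((Z + a + 1)! : ℝ) ≠ 0 := by positivity
        have h0 : ((Z + 2).ascFactorial a : ℝ) ≠ 0 := fun h => this (by rw [← hZa, h, mul_zero])
        exact lt_of_le_of_ne (by positivity) h0.symm
      set A : ℝ := ((Z + 2).ascFactorial a : ℝ) with hAdef
      set T : ℝ := ((2 : ℕ).ascFactorial a : ℝ) with hTdef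
      have hT0 : 0 ≤ T := by positivity
      suffices hs : (1 + r * (T / A)) * (Real.exp (6 * r / ((Z + a : ℕ) + 2)) *
              ∏ i ∈ Finset.range ((Q.erase q).filter (fun x => v x = 1)).card,
                (1 + 2 * r / (((Z + a : ℕ) : ℝ) + 2 + i))) ≤
          Real.exp (6 * r / ((Z : ℕ) + 2)) *
        ∏ i ∈ Finset.range (Q.filter (fun x => v x = 1)).card,
          (1 + 2 * r / ((Z : ℝ) + 2 + i)) by
        rw [hsumQ, ← hZa, show Z + 1 + (a + V) = Z + a + 1 + V by ring]
        calc _ = (∏ b ∈ B, ((c b)! : ℝ)) * (((Z + a + 1 + V)! : ℝ) / ((Z + 1)! : ℝ)) *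
              ((1 + r * (T / A)) * (Real.exp (6 * r / ((Z + a : ℕ) + 2)) *
              ∏ i ∈ Finset.range ((Q.erase q).filter (fun x => v x = 1)).card,
                (1 + 2 * r / (((Z + a : ℕ) : ℝ) + 2 + i)))) := by
              field_simp
          _ ≤ _ := mul_le_mul_of_nonneg_left hs (by positivity)
      rcases hq with hq1 | hq0
      · have hcard : (Q.filter (fun x => v x = 1)).card =
            ((Q.erase q).filter (fun x => v x = 1)).card + 1 := by
          rw [Finset.filter_erase, Finset.card_erase_add_one]
          exact Finset.mem_filter.2 ⟨hqQ, hq1⟩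
        rw [hcard, Finset.prod_range_succ']
        have hT : T = 2 := by rw [hTdef, hq1]; norm_num [Nat.ascFactorial_succ]
        have hA' : A = Z + 2 := by
          rw [hAdef, hq1]
          simp [Nat.ascFactorial_succ]
        rw [hT, hA', hq1]
        have hexp : Real.exp (6 * r / ((Z + 1 : ℕ) + 2)) ≤ Real.exp (6 * r / ((Z : ℕ) + 2)) := by
          refine Real.exp_le_exp.2 ?_
          push_cast
          gcongr
          linarith
        have hprod : ∏ i ∈ Finset.range ((Q.erase q).filter (fun x => v x = 1)).card,
            (1 + 2 * r / (((Z + 1 : ℕ) : ℝ) + 2 + i)) =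
            ∏ i ∈ Finset.range ((Q.erase q).filter (fun x => v x = 1)).card,
            (1 + 2 * r / ((Z : ℝ) + 2 + (i + 1 : ℕ))) := by
          refine Finset.prod_congr rfl fun i _ => ?_
          push_cast
          ring_nf
        rw [hprod]
        set P := ∏ i ∈ Finset.range ((Q.erase q).filter (fun x => v x = 1)).card,
            (1 + 2 * r / ((Z : ℝ) + 2 + (i + 1 : ℕ)))
        have hP0 : 0 ≤ P := Finset.prod_nonneg fun _ _ => by positivity
        calc (1 + (r : ℝ) * (2 / (Z + 2))) * (Real.exp (6 * r / ((Z + 1 : ℕ) + 2)) * P)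
            ≤ (1 + (r : ℝ) * (2 / (Z + 2))) * (Real.exp (6 * r / ((Z : ℕ) + 2)) * P) := by
              gcongr
          _ = _ := by
              rw [Nat.cast_zero, add_zero]
              ring
      · have h0 : (Q.erase q).filter (fun x => v x = 1) = ∅ := by
          rw [Finset.filter_erase, hq0, Finset.erase_empty]
        have ha2 : 2 ≤ a := by
          have : q ∉ Q.filter (fun x => v x = 1) := by rw [hq0]; exact Finset.notMem_empty q
          rw [Finset.mem_filter] at this
          have : a ≠ 1 := fun h => this ⟨hqQ, h⟩
          omega
        rw [h0, hq0, Finset.card_empty, Finset.range_zero, Finset.prod_empty, Finset.prod_empty,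
          mul_one, mul_one]
        have hTA : T / A ≤ 6 * (1 / ((Z : ℝ) + 2) - 1 / (Z + 3)) := by
          have h6 := two_ascFactorial_mul_le Z ha2
          have h6' : T * ((Z + 2) * (Z + 3)) ≤ 6 * A := by
            rw [hTdef, hAdef]
            exact_mod_cast h6
          rw [div_le_iff₀ hA]
          have e : 6 * (1 / ((Z : ℝ) + 2) - 1 / (Z + 3)) * A = 6 * A / ((Z + 2) * (Z + 3)) := by
            field_simp
            ring
          rw [e, le_div_iff₀ (by positivity)]
          exact h6'
        have hr0 : (0 : ℝ) ≤ r := by positivity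
        have e1 : 1 + r * (T / A) ≤
            Real.exp (6 * r * (1 / ((Z : ℝ) + 2)) - 6 * r * (1 / (Z + 3))) := by
          refine le_trans ?_ (Real.add_one_le_exp _)
          nlinarith [mul_le_mul_of_nonneg_left hTA hr0]
        have e2 : Real.exp (6 * r / ((Z + a : ℕ) + 2)) ≤ Real.exp (6 * r * (1 / ((Z : ℝ) + 3))) := by
          refine Real.exp_le_exp.2 ?_
          rw [mul_one_div]
          have : (2 : ℝ) ≤ a := by exact_mod_cast ha2
          push_cast
          exact div_le_div_of_nonneg_left (by positivity) (by positivity) (by linarith)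
        calc (1 + r * (T / A)) * Real.exp (6 * r / ((Z + a : ℕ) + 2))
            ≤ Real.exp (6 * r * (1 / ((Z : ℝ) + 2)) - 6 * r * (1 / (Z + 3))) *
              Real.exp (6 * r * (1 / ((Z : ℝ) + 3))) := by gcongr
          _ = Real.exp (6 * r / (Z + 2)) := by
              rw [← Real.exp_add]
              ring_nf
  exact main Q.card Q rfl hv c hc

theorem prod_one_add_div_le (r Z t : ℕ) (ht : t ≤ 2 * r) :
    ∏ i ∈ Finset.range t, (1 + 2 * r / ((Z : ℝ) + 2 + i)) ≤ 16 ^ r := by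
  have h1 : ∏ i ∈ Finset.range t, (1 + 2 * r / ((Z : ℝ) + 2 + i)) ≤ (2 * r + t).choose t := by
    calc ∏ i ∈ Finset.range t, (1 + 2 * r / ((Z : ℝ) + 2 + i))
        ≤ ∏ i ∈ Finset.range t, (1 + 2 * r / ((i : ℝ) + 1)) := by
          refine Finset.prod_le_prod (fun _ _ => by positivity) fun i _ => ?_
          have : (0 : ℝ) ≤ Z := by positivity
          exact add_le_add_right
            (div_le_div_of_nonneg_left (by positivity) (by positivity) (by linarith)) 1
      _ = (2 * r + t).choose t := by
          clear ht
          induction t with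
          | zero => simp
          | succ t ih =>
            rw [Finset.prod_range_succ, ih]
            have h := Nat.add_one_mul_choose_eq (2 * r + t) t
            have h' : ((2 * r + t : ℝ) + 1) * (2 * r + t).choose t =
                (2 * r + t + 1).choose (t + 1) * (t + 1) := by exact_mod_cast h
            rw [← add_assoc]
            have ht0 : (t : ℝ) + 1 ≠ 0 := by positivity
            field_simp
            linarith
  refine h1.trans ?_
  have h2 := (Nat.choose_le_two_pow (2 * r + t) t).trans
    (Nat.pow_le_pow_right (n := 2) (by norm_num) (show 2 * r + t ≤ 4 * r by omega))
  rw [pow_mul] at h2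
  exact_mod_cast h2

theorem attachSum_le_pow {v : ι → ℕ} {B : Finset ι} {r : ℕ} (hB : B.card = r + 1) {Q : Finset ι}
    (hv : ∀ x, 1 ≤ v x) (hQ : (Q.filter (fun x => v x = 1)).card ≤ 2 * r) :
    attachSum v B v Q ≤ 336 ^ r * (∏ b ∈ B, ((v b)! : ℝ)) *
      (((∑ b ∈ B, (v b - 1) + 1 + ∑ x ∈ Q, v x)! : ℝ) / ((∑ b ∈ B, (v b - 1) + 1)! : ℝ)) := by
  refine (attachSum_le hB (fun x _ => hv x) fun b _ => hv b).trans ?_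
  have h1 := prod_one_add_div_le r (∑ b ∈ B, (v b - 1)) _ hQ
  have h2 : Real.exp (6 * r / ((∑ b ∈ B, (v b - 1) : ℕ) + 2)) ≤ 21 ^ r := by
    calc Real.exp (6 * r / ((∑ b ∈ B, (v b - 1) : ℕ) + 2)) ≤ Real.exp (r * 3) := by
          refine Real.exp_le_exp.2 ?_
          rw [div_le_iff₀ (by positivity)]
          have : (0 : ℝ) ≤ r * (∑ b ∈ B, (v b - 1) : ℕ) := by positivity
          nlinarith
      _ = Real.exp 3 ^ r := Real.exp_nat_mul 3 r
      _ ≤ 21 ^ r := by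
          refine pow_le_pow_left₀ (Real.exp_pos _).le ?_ r
          have h3 : Real.exp 3 = Real.exp 1 ^ 3 := by
            rw [← Real.exp_nat_mul]
            norm_num
          have := Real.exp_one_lt_d9
          rw [h3]
          calc Real.exp 1 ^ 3 ≤ 2.7182818286 ^ 3 := by gcongr
            _ ≤ 21 := by norm_num
  calc _ ≤ (∏ b ∈ B, ((v b)! : ℝ)) *
      (((∑ b ∈ B, (v b - 1) + 1 + ∑ x ∈ Q, v x)! : ℝ) / ((∑ b ∈ B, (v b - 1) + 1)! : ℝ)) *
      (21 ^ r * 16 ^ r) := by gcongr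
    _ = _ := by
      rw [← mul_pow]
      norm_num
      ring

theorem sum_prod_factorial_le_attachSum (v : ι → ℕ) (B : Finset ι)
    (F : Finset (Finset (Finset ι)))
    (hF : ∀ α ∈ F, IsSetPartitionOn Finset.univ α ∧ ∀ s ∈ α, ∃! b, b ∈ s ∧ b ∈ B) :
    ∑ α ∈ F, ∏ s ∈ α, ((∑ x ∈ s, v x)! : ℝ) ≤ attachSum v B v (Finset.univ \ B) := by
  have hex : ∀ α ∈ F, ∃ f : ι → ι, (∀ x, f x ∈ B ∧ ∃ s ∈ α, x ∈ s ∧ f x ∈ s) := by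
    intro α hα
    have : ∀ x, ∃ b, b ∈ B ∧ ∃ s ∈ α, x ∈ s ∧ b ∈ s := by
      intro x
      obtain ⟨s, ⟨hs, hx⟩, -⟩ := (hF α hα).1.2 x (Finset.mem_univ x)
      obtain ⟨b, ⟨hb, hbB⟩, -⟩ := (hF α hα).2 s hs
      exact ⟨b, hbB, s, hs, hx, hb⟩
    exact ⟨fun x => (this x).choose, fun x => (this x).choose_spec⟩
  have : Nonempty (ι → ι) := ⟨id⟩
  choose! f hf using hex
  have hfix : ∀ α ∈ F, ∀ b ∈ B, f α b = b := by
    intro α hα b hb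
    obtain ⟨hB, s, hs, hbs, hfs⟩ := hf α hα b
    exact ((hF α hα).2 s hs).unique ⟨hfs, hB⟩ ⟨hbs, hb⟩
  have hfib : ∀ α ∈ F, α = B.image (fun b => Finset.univ.filter (fun x => f α x = b)) := by
    intro α hα
    have key : ∀ s ∈ α, ∀ b ∈ s, b ∈ B → Finset.univ.filter (fun x => f α x = b) = s := by
      intro s hs b hbs hbB
      ext x
      rw [Finset.mem_filter]
      obtain ⟨hB, t, ht, hxt, hft⟩ := hf α hα x
      constructor
      · rintro ⟨-, rfl⟩
        have : s = t := ((hF α hα).1.2 (f α x) (Finset.mem_univ _)).unique ⟨hs, hbs⟩ ⟨ht, hft⟩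
        rw [this]
        exact hxt
      · intro hxs
        have hst : s = t := ((hF α hα).1.2 x (Finset.mem_univ _)).unique ⟨hs, hxs⟩ ⟨ht, hxt⟩
        subst hst
        exact ⟨Finset.mem_univ _, ((hF α hα).2 s hs).unique ⟨hft, hB⟩ ⟨hbs, hbB⟩⟩
    ext s
    rw [Finset.mem_image]
    constructor
    · intro hs
      obtain ⟨b, ⟨hb, hbB⟩, -⟩ := (hF α hα).2 s hs
      exact ⟨b, hbB, key s hs b hb hbB⟩
    · rintro ⟨b, hbB, rfl⟩
      obtain ⟨s, ⟨hs, hb⟩, -⟩ := (hF α hα).1.2 b (Finset.mem_univ b)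
      rw [key s hs b hb hbB]
      exact hs
  have hval : ∀ α ∈ F, ∏ s ∈ α, ((∑ x ∈ s, v x)! : ℝ) =
      ∏ b ∈ B, ((v b + ∑ x ∈ Finset.univ \ B, if f α x = b then v x else 0)! : ℝ) := by
    intro α hα
    conv_lhs => rw [hfib α hα]
    rw [Finset.prod_image]
    · refine Finset.prod_congr rfl fun b hb => ?_
      congr 2
      rw [Finset.sum_filter, ← Finset.sum_sdiff (Finset.subset_univ B), add_comm]
      congr 1
      rw [Finset.sum_eq_single_of_mem b hb, if_pos (hfix α hα b hb)]
      intro x hx hxb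
      rw [if_neg]
      rwa [hfix α hα x hx]
    · intro b hb b' hb' h
      have : b ∈ Finset.univ.filter (fun x => f α x = b) :=
        Finset.mem_filter.2 ⟨Finset.mem_univ _, hfix α hα b hb⟩
      simp only at h
      rw [h, Finset.mem_filter, hfix α hα b hb] at this
      exact this.2
  unfold attachSum
  rw [Finset.sum_congr rfl hval]
  have hinj : Set.InjOn f F := by
    intro α hα β hβ h
    rw [hfib α hα, hfib β hβ, h]
  rw [← Finset.sum_image (f := fun g : ι → ι =>
    ∏ b ∈ B, ((v b + ∑ x ∈ Finset.univ \ B, if g x = b then v x else 0)! : ℝ)) hinj]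
  refine Finset.sum_le_sum_of_subset_of_nonneg ?_ fun _ _ _ => by positivity
  intro g hg
  obtain ⟨α, hα, rfl⟩ := Finset.mem_image.1 hg
  rw [Fintype.mem_piFinset]
  intro x
  by_cases hx : x ∈ B
  · simp [hx, hfix α hα x hx]
  · simp [hx, (hf α hα x).1]

end Insertion

section Transversal

variable {ι J : Type*} [DecidableEq ι] [Fintype ι] [Fintype J]

/-- The elements outside the image of a section `p` of `π`, together with `p₀`. -/
noncomputable def sectionCompl (π : ι → J) (p₀ : ι) (p : J → ι) : Finset ι :=
  Finset.univ.filter fun b => b ≠ p (π b) ∨ b = p₀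

theorem card_sectionCompl {π : ι → J} {p₀ : ι} {p : J → ι} (hp : ∀ j, π (p j) = j)
    (h₀ : p (π p₀) = p₀) :
    (sectionCompl π p₀ p).card + Fintype.card J = Fintype.card ι + 1 := by
  have hinj : Function.Injective p := fun i j h => by rw [← hp i, ← hp j, h]
  have h1 : (sectionCompl π p₀ p) = insert p₀ (Finset.univ \ Finset.univ.image p) := by
    ext b
    simp only [sectionCompl, Finset.mem_filter, Finset.mem_univ, true_and, Finset.mem_insert,
      Finset.mem_sdiff, Finset.mem_image, not_exists]
    constructor
    · rintro (h | h)
      · refine Or.inr fun j hj => h ?_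
        rw [← hj, hp]
      · exact Or.inl h
    · rintro (h | h)
      · exact Or.inr h
      · exact Or.inl fun h' => h _ h'.symm
  have h2 : p₀ ∉ Finset.univ \ Finset.univ.image p := by
    rw [Finset.mem_sdiff, not_and, not_not]
    exact fun _ => Finset.mem_image.2 ⟨_, Finset.mem_univ _, h₀⟩
  have h3 : (Finset.univ.image p).card = Fintype.card J := by
    rw [Finset.card_image_of_injective _ hinj, Finset.card_univ]
  have h4 := Finset.card_le_univ (Finset.univ.image p)
  rw [h1, Finset.card_insert_of_notMem h2, Finset.card_sdiff_of_subset (Finset.subset_univ _), h3,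
    Finset.card_univ]
  omega

variable [DecidableEq J]

/-- The set partition of `ι` into the fibers of a map. -/
noncomputable def fiberPartition (π : ι → J) : Finset (Finset ι) :=
  Finset.univ.image fun j => Finset.univ.filter fun x => π x = j

/-- The sections of `π` taking the value `p₀`. -/
noncomputable def sectionsThrough (π : ι → J) (p₀ : ι) : Finset (J → ι) :=
  Finset.univ.filter fun p => (∀ j, π (p j) = j) ∧ p (π p₀) = p₀

theorem card_fiberPartition {π : ι → J} (hπ : Function.Surjective π) :
    (fiberPartition π).card = Fintype.card J := by
  unfold fiberPartition
  rw [Finset.card_image_of_injective, Finset.card_univ]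
  intro i j h
  obtain ⟨x, rfl⟩ := hπ i
  have : x ∈ Finset.univ.filter fun y => π y = π x := by simp
  simp only at h
  rw [h, Finset.mem_filter] at this
  exact this.2

theorem exists_section_forall_mem {π : ι → J} (hπ : Function.Surjective π) (p₀ : ι)
    {α : Finset (Finset ι)} (hα : IsSetPartitionOn Finset.univ α)
    (hc : ∀ γ : Finset (Finset ι), IsSetPartitionOn Finset.univ γ →
      Refines (fiberPartition π) γ → Refines α γ → γ = {Finset.univ}) :
    ∃ p : J → ι, (∀ j, π (p j) = j) ∧ p (π p₀) = p₀ ∧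
      ∀ s ∈ α, ∃ b ∈ s, b ∈ sectionCompl π p₀ p := by
  by_contra hno
  have main : ∀ k : ℕ, ∃ (W : Finset J) (𝓑 : Finset (Finset ι)) (p : J → ι),
      (∀ j, π (p j) = j) ∧ p (π p₀) = p₀ ∧ π p₀ ∈ W ∧ 𝓑 ⊆ α ∧ (∀ j ∈ W, ∃ s ∈ 𝓑, p j ∈ s) ∧
      (∀ s ∈ 𝓑, ∃ b ∈ s, b = p₀ ∨ (b ≠ p (π b) ∧ π b ∈ W)) ∧ k ≤ W.card + 𝓑.card := by
    intro k
    induction k with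
    | zero =>
      obtain ⟨s, ⟨hs, hps⟩, -⟩ := hα.2 p₀ (Finset.mem_univ _)
      obtain ⟨q, hq⟩ := hπ.hasRightInverse
      refine ⟨{π p₀}, {s}, Function.update q (π p₀) p₀, fun j => ?_, Function.update_self _ _ _,
        Finset.mem_singleton_self _, Finset.singleton_subset_iff.2 hs, ?_, ?_, Nat.zero_le _⟩
      · by_cases h : j = π p₀
        · rw [h, Function.update_self]
        · rw [Function.update_of_ne h, hq]
      · intro j hj
        rw [Finset.mem_singleton] at hj
        exact ⟨s, Finset.mem_singleton_self _, by rwa [hj, Function.update_self]⟩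
      · intro t ht
        rw [Finset.mem_singleton] at ht
        exact ⟨p₀, ht ▸ hps, Or.inl rfl⟩
    | succ k ih =>
      obtain ⟨W, 𝓑, p, hp, h₀, hW, h𝓑, h1, h2, hk⟩ := ih
      by_cases hext1 : ∃ s ∈ 𝓑, ∃ x ∈ s, π x ∉ W
      · obtain ⟨s, hs, x, hxs, hxW⟩ := hext1
        have hne : ∀ j ∈ W, j ≠ π x := fun j hj h => hxW (h ▸ hj)
        refine ⟨insert (π x) W, 𝓑, Function.update p (π x) x, fun j => ?_, ?_,
          Finset.mem_insert_of_mem hW, h𝓑, ?_, ?_, ?_⟩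
        · by_cases h : j = π x
          · rw [h, Function.update_self]
          · rw [Function.update_of_ne h, hp]
        · rw [Function.update_of_ne (hne _ hW), h₀]
        · intro j hj
          rcases Finset.mem_insert.1 hj with rfl | hj
          · exact ⟨s, hs, by rwa [Function.update_self]⟩
          · rw [Function.update_of_ne (hne _ hj)]
            exact h1 j hj
        · intro t ht
          obtain ⟨b, hb, hb'⟩ := h2 t ht
          refine ⟨b, hb, hb'.imp id fun h => ⟨?_, Finset.mem_insert_of_mem h.2⟩⟩
          rw [Function.update_of_ne (hne _ h.2)]
          exact h.1
        · rw [Finset.card_insert_of_notMem hxW]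
          omega
      by_cases hext2 : ∃ x, π x ∈ W ∧ ∀ s ∈ 𝓑, x ∉ s
      · obtain ⟨x, hxW, hx⟩ := hext2
        obtain ⟨s, ⟨hs, hxs⟩, -⟩ := hα.2 x (Finset.mem_univ _)
        refine ⟨W, insert s 𝓑, p, hp, h₀, hW, Finset.insert_subset hs h𝓑, ?_, ?_, ?_⟩
        · intro j hj
          obtain ⟨t, ht, hjt⟩ := h1 j hj
          exact ⟨t, Finset.mem_insert_of_mem ht, hjt⟩
        · intro t ht
          rcases Finset.mem_insert.1 ht with rfl | ht
          · refine ⟨x, hxs, Or.inr ⟨fun h => ?_, hxW⟩⟩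
            obtain ⟨t', ht', hjt'⟩ := h1 _ hxW
            rw [← h] at hjt'
            exact hx t' ht' hjt'
          · exact h2 t ht
        · rw [Finset.card_insert_of_notMem fun h => hx s h hxs]
          omega
      exfalso
      push Not at hext1 hext2
      set U := Finset.univ.filter (fun x => π x ∈ W) with hU
      have hUmem : ∀ x, x ∈ U ↔ π x ∈ W := fun x => by simp [hU]
      have hUuniv : U = Finset.univ := by
        by_contra hUne
        have hUc : Uᶜ ≠ ∅ := by rwa [Ne, Finset.compl_eq_empty_iff]
        have hγ := hc {U, Uᶜ} ⟨?_, ?_⟩ ?_ ?_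
        · have : U ∈ ({U, Uᶜ} : Finset (Finset ι)) := Finset.mem_insert_self _ _
          rw [hγ, Finset.mem_singleton] at this
          exact hUne this
        · intro s hs
          rw [Finset.mem_insert, Finset.mem_singleton] at hs
          refine ⟨Finset.subset_univ _, ?_⟩
          rcases hs with rfl | rfl
          · exact Finset.ne_empty_of_mem ((hUmem p₀).2 hW)
          · exact hUc
        · intro x _
          by_cases hx : x ∈ U
          · refine ⟨U, ⟨Finset.mem_insert_self _ _, hx⟩, ?_⟩
            rintro t ⟨ht, hxt⟩
            rw [Finset.mem_insert, Finset.mem_singleton] at ht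
            rcases ht with rfl | rfl
            · rfl
            · exact absurd hx (Finset.mem_compl.1 hxt)
          · refine ⟨Uᶜ, ⟨by simp, Finset.mem_compl.2 hx⟩, ?_⟩
            rintro t ⟨ht, hxt⟩
            rw [Finset.mem_insert, Finset.mem_singleton] at ht
            rcases ht with rfl | rfl
            · exact absurd hxt hx
            · rfl
        · intro s hs
          obtain ⟨j, -, rfl⟩ := Finset.mem_image.1 hs
          by_cases hj : j ∈ W
          · refine ⟨U, Finset.mem_insert_self _ _, fun x hx => ?_⟩
            rw [Finset.mem_filter] at hx
            rw [hUmem, hx.2]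
            exact hj
          · refine ⟨Uᶜ, by simp, fun x hx => ?_⟩
            rw [Finset.mem_filter] at hx
            rw [Finset.mem_compl, hUmem, hx.2]
            exact hj
        · intro s hs
          by_cases hs𝓑 : s ∈ 𝓑
          · exact ⟨U, Finset.mem_insert_self _ _, fun x hx => (hUmem x).2 (hext1 s hs𝓑 x hx)⟩
          · refine ⟨Uᶜ, by simp, fun x hx => ?_⟩
            rw [Finset.mem_compl, hUmem]
            intro hxW
            obtain ⟨t, ht, hxt⟩ := hext2 x hxW
            have : s = t := (hα.2 x (Finset.mem_univ _)).unique ⟨hs, hx⟩ ⟨h𝓑 ht, hxt⟩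
            exact hs𝓑 (this ▸ ht)
      refine hno ⟨p, hp, h₀, fun s hs => ?_⟩
      obtain ⟨x, hx⟩ := Finset.nonempty_iff_ne_empty.2 (hα.1 s hs).2
      have hxW : π x ∈ W := by rw [← hUmem, hUuniv]; exact Finset.mem_univ _
      obtain ⟨t, ht, hxt⟩ := hext2 x hxW
      have hst : s = t := (hα.2 x (Finset.mem_univ _)).unique ⟨hs, hx⟩ ⟨h𝓑 ht, hxt⟩
      obtain ⟨b, hb, hb'⟩ := h2 t ht
      refine ⟨b, hst ▸ hb, Finset.mem_filter.2 ⟨Finset.mem_univ _, ?_⟩⟩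
      exact hb'.elim Or.inr fun h => Or.inl h.1
  obtain ⟨W, 𝓑, p, -, -, -, h𝓑, -, -, hk⟩ := main (Fintype.card J + α.card + 1)
  have := Finset.card_le_univ W
  have := Finset.card_le_card h𝓑
  omega

theorem exists_section_transversal {π : ι → J} (hπ : Function.Surjective π) (p₀ : ι)
    {α : Finset (Finset ι)} (hα : IsSetPartitionOn Finset.univ α)
    (hc : IsComplementary (fiberPartition π) α) :
    ∃ p ∈ sectionsThrough π p₀, ∀ s ∈ α, ∃! b, b ∈ s ∧ b ∈ sectionCompl π p₀ p := by
  obtain ⟨p, hp, h₀, hmem⟩ := exists_section_forall_mem hπ p₀ hα hc.2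
  refine ⟨p, Finset.mem_filter.2 ⟨Finset.mem_univ _, hp, h₀⟩, fun s hs => ?_⟩
  have hcard : (sectionCompl π p₀ p).card = α.card := by
    have h1 := card_sectionCompl hp h₀
    have h2 := hc.1
    rw [card_fiberPartition hπ] at h2
    omega
  have : Nonempty ι := ⟨p₀⟩
  choose! b hb hb' using hmem
  have hinj : Set.InjOn b (α : Set (Finset ι)) := by
    intro t ht t' ht' h
    rw [Finset.mem_coe] at ht ht'
    exact (hα.2 (b t) (Finset.mem_univ _)).unique ⟨ht, hb t ht⟩ ⟨ht', h ▸ hb t' ht'⟩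
  have himg : α.image b = sectionCompl π p₀ p := by
    refine Finset.eq_of_subset_of_card_le ?_ ?_
    · intro x hx
      obtain ⟨t, ht, rfl⟩ := Finset.mem_image.1 hx
      exact hb' t ht
    · rw [Finset.card_image_of_injOn hinj, hcard]
  refine ⟨b s, ⟨hb s hs, hb' s hs⟩, ?_⟩
  rintro x ⟨hxs, hxB⟩
  rw [← himg] at hxB
  obtain ⟨t, ht, rfl⟩ := Finset.mem_image.1 hxB
  have : t = s := (hα.2 (b t) (Finset.mem_univ _)).unique ⟨ht, hb t ht⟩ ⟨hs, hxs⟩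
  rw [this]

theorem sum_complementary_prod_factorial_le {π : ι → J} (hπ : Function.Surjective π) (p₀ : ι)
    (v : ι → ℕ) :
    ∑ α ∈ Finset.univ.filter (fun α : Finset (Finset ι) =>
        IsSetPartitionOn Finset.univ α ∧ IsComplementary (fiberPartition π) α),
      ∏ s ∈ α, ((∑ x ∈ s, v x)! : ℝ) ≤
    ∑ p ∈ sectionsThrough π p₀,
      attachSum v (sectionCompl π p₀ p) v (Finset.univ \ sectionCompl π p₀ p) := by
  set F := Finset.univ.filter (fun α : Finset (Finset ι) =>
        IsSetPartitionOn Finset.univ α ∧ IsComplementary (fiberPartition π) α)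
  set G : (J → ι) → Finset (Finset (Finset ι)) := fun p =>
    F.filter (fun α => ∀ s ∈ α, ∃! b, b ∈ s ∧ b ∈ sectionCompl π p₀ p) with hG
  calc ∑ α ∈ F, ∏ s ∈ α, ((∑ x ∈ s, v x)! : ℝ)
      ≤ ∑ α ∈ F, ∑ p ∈ (sectionsThrough π p₀).filter
          (fun p => ∀ s ∈ α, ∃! b, b ∈ s ∧ b ∈ sectionCompl π p₀ p),
          ∏ s ∈ α, ((∑ x ∈ s, v x)! : ℝ) := by
        refine Finset.sum_le_sum fun α hα => ?_
        rw [Finset.mem_filter] at hα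
        obtain ⟨p, hp, hps⟩ := exists_section_transversal hπ p₀ hα.2.1 hα.2.2
        exact Finset.single_le_sum (f := fun _ : J → ι => ∏ s ∈ α, ((∑ x ∈ s, v x)! : ℝ))
          (fun _ _ => by positivity) (Finset.mem_filter.2 ⟨hp, hps⟩)
    _ = ∑ p ∈ sectionsThrough π p₀, ∑ α ∈ G p, ∏ s ∈ α, ((∑ x ∈ s, v x)! : ℝ) := by
        refine Finset.sum_comm' fun α p => ?_
        simp only [hG, Finset.mem_filter]
        tauto
    _ ≤ _ := by
        refine Finset.sum_le_sum fun p _ => ?_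
        refine sum_prod_factorial_le_attachSum v _ _ fun α hα => ?_
        simp only [hG, F, Finset.mem_filter] at hα
        exact ⟨hα.1.2.1, hα.2⟩

end Transversal

section MultiBound

/-- The weight `6 / ((c + 1) (c + 2))` bounding the contribution of a part `c`. -/
noncomputable def partWeight (c : ℕ) : ℝ := 6 / (((c : ℝ) + 1) * ((c : ℝ) + 2))

theorem partWeight_nonneg (c : ℕ) : 0 ≤ partWeight c := by
  unfold partWeight
  positivity

theorem sum_Icc_partWeight_le (m : ℕ) : ∑ c ∈ Finset.Icc 1 m, partWeight c ≤ 3 := by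
  have h : ∑ c ∈ Finset.Icc 1 m, partWeight c = 3 - 6 / ((m : ℝ) + 2) := by
    induction m with
    | zero => norm_num
    | succ k ih =>
      rw [Finset.sum_Icc_succ_top (by omega), ih, partWeight]
      push_cast
      field_simp
      ring
  rw [h]
  have : 0 ≤ 6 / ((m : ℝ) + 2) := by positivity
  linarith

theorem factorial_mul_factorial_add_three_le {X : ℕ} (hX : 3 ≤ X) (c : ℕ) :
    X ! * (c + 3)! ≤ 6 * (X + c)! := by
  induction c with
  | zero => simp [Nat.factorial]; omega
  | succ c ih =>
    rw [show c + 1 + 3 = (c + 3) + 1 by ring, ← add_assoc, Nat.factorial_succ (c + 3),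
      Nat.factorial_succ (X + c)]
    calc X ! * ((c + 3 + 1) * (c + 3)!) = (c + 3 + 1) * (X ! * (c + 3)!) := by ring
      _ ≤ (X + c + 1) * (6 * (X + c)!) := Nat.mul_le_mul (by omega) ih
      _ = _ := by ring

theorem factorial_mul_prod_factorial_le {ι : Type*} (E : Finset ι) (v : ι → ℕ)
    (hv : ∀ e ∈ E, 1 ≤ v e) {X : ℕ} (hX : 3 ≤ X) :
    X ! * ∏ e ∈ E, (v e + 2)! ≤ 6 ^ E.card * (X + ∑ e ∈ E, (v e - 1))! := by
  classical
  induction E using Finset.induction_on with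
  | empty => simp
  | insert a E ha ih =>
    have ha1 := hv a (Finset.mem_insert_self _ _)
    rw [Finset.prod_insert ha, Finset.sum_insert ha, Finset.card_insert_of_notMem ha,
      show v a + 2 = (v a - 1) + 3 by omega]
    have h1 := ih fun e he => hv e (Finset.mem_insert_of_mem he)
    have h2 := factorial_mul_factorial_add_three_le
      (X := X + ∑ e ∈ E, (v e - 1)) (by omega) (v a - 1)
    calc X ! * (((v a - 1) + 3)! * ∏ e ∈ E, (v e + 2)!)
        = (X ! * ∏ e ∈ E, (v e + 2)!) * ((v a - 1) + 3)! := by ring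
      _ ≤ (6 ^ E.card * (X + ∑ e ∈ E, (v e - 1))!) * ((v a - 1) + 3)! :=
          Nat.mul_le_mul_right _ h1
      _ = 6 ^ E.card * ((X + ∑ e ∈ E, (v e - 1))! * ((v a - 1) + 3)!) := by ring
      _ ≤ 6 ^ E.card * (6 * (X + ∑ e ∈ E, (v e - 1) + (v a - 1))!) := Nat.mul_le_mul_left _ h2
      _ = _ := by rw [_root_.pow_succ, mul_assoc, add_assoc, add_comm (∑ e ∈ E, (v e - 1))]

theorem one_add_mul_succ_le_four_pow (r : ℕ) : 1 + r * (r + 1) ≤ 4 ^ r := by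
  induction r with
  | zero => simp
  | succ k ih =>
    rw [_root_.pow_succ]
    nlinarith

theorem factorial_mul_prod_factorial_le_partWeight {ι : Type*} (E : Finset ι) (v : ι → ℕ)
    (hv : ∀ e ∈ E, 1 ≤ v e) (b : ℕ) (hb : 1 ≤ b)
    (hvb : ∀ e ∈ E, v e - 1 ≤ (E.card + 1) * (b + 1)) :
    (b ! : ℝ) * ∏ e ∈ E, ((v e)! : ℝ) ≤
      16 ^ E.card * (∏ e ∈ E, partWeight (v e)) * ((b + ∑ e ∈ E, (v e - 1))! : ℝ) := by
  set r := E.card with hr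
  set S := ∑ e ∈ E, (v e - 1) with hS
  have h1 := factorial_mul_prod_factorial_le E v hv (X := b + 2) (by omega)
  rw [← hr, ← hS] at h1
  have hSle : S ≤ r * ((r + 1) * (b + 1)) := by
    rw [hS, hr, ← smul_eq_mul (a := E.card)]
    exact Finset.sum_le_card_nsmul _ _ _ hvb
  have h4 := one_add_mul_succ_le_four_pow r
  have h2 : b + 1 + S ≤ 4 ^ r * (b + 1) := by nlinarith
  have h3 : b + 2 + S ≤ 4 ^ r * (b + 2) := by nlinarith
  have hfac : ∀ c : ℕ, ((c + 2)! : ℝ) = (c ! : ℝ) * (((c : ℝ) + 1) * ((c : ℝ) + 2)) := by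
    intro c
    rw [Nat.factorial_succ, Nat.factorial_succ]
    push_cast
    ring
  have h5 : ((b + 2 + S)! : ℝ) ≤
      (16 : ℝ) ^ r * (((b : ℝ) + 1) * ((b : ℝ) + 2)) * ((b + S)! : ℝ) := by
    have : (b + 2 + S)! ≤ 4 ^ r * (b + 2) * (4 ^ r * (b + 1) * (b + S)!) := by
      rw [show b + 2 + S = (b + S + 1) + 1 by ring, Nat.factorial_succ, Nat.factorial_succ]
      exact Nat.mul_le_mul (by omega) (Nat.mul_le_mul_right _ (by omega))
    calc ((b + 2 + S)! : ℝ) ≤ ((4 ^ r * (b + 2) * (4 ^ r * (b + 1) * (b + S)!) : ℕ) : ℝ) := by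
          exact_mod_cast this
      _ = _ := by
          push_cast
          rw [show (16 : ℝ) = 4 * 4 by norm_num, mul_pow]
          ring
  have h6 : (((b + 2)! : ℕ) : ℝ) * ∏ e ∈ E, ((v e + 2)! : ℝ) ≤ 6 ^ r * ((b + 2 + S)! : ℝ) := by
    exact_mod_cast h1
  have hprod : ∏ e ∈ E, ((v e + 2)! : ℝ) * partWeight (v e) = 6 ^ r * ∏ e ∈ E, ((v e)! : ℝ) := by
    rw [hr, ← Finset.prod_const, ← Finset.prod_mul_distrib]
    refine Finset.prod_congr rfl fun e _ => ?_
    rw [hfac, partWeight]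
    field_simp
  have hW : 0 ≤ ∏ e ∈ E, partWeight (v e) := Finset.prod_nonneg fun _ _ => partWeight_nonneg _
  have hbpos : (0 : ℝ) < ((b : ℝ) + 1) * ((b : ℝ) + 2) := by positivity
  have h6pos : (0 : ℝ) < 6 ^ r := by positivity
  rw [hfac] at h6
  rw [Finset.prod_mul_distrib] at hprod
  have h7 := mul_le_mul_of_nonneg_right (h6.trans (mul_le_mul_of_nonneg_left h5 h6pos.le)) hW
  refine _root_.le_of_mul_le_mul_left ?_ (mul_pos hbpos h6pos)
  calc ((b : ℝ) + 1) * ((b : ℝ) + 2) * 6 ^ r * ((b ! : ℝ) * ∏ e ∈ E, ((v e)! : ℝ))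
      = (b ! : ℝ) * (((b : ℝ) + 1) * ((b : ℝ) + 2)) * (6 ^ r * ∏ e ∈ E, ((v e)! : ℝ)) := by ring
    _ = (b ! : ℝ) * (((b : ℝ) + 1) * ((b : ℝ) + 2)) * (∏ e ∈ E, ((v e + 2)! : ℝ)) *
          ∏ e ∈ E, partWeight (v e) := by rw [← hprod]; ring
    _ ≤ _ := h7
    _ = _ := by ring

variable {ι J : Type*} [DecidableEq ι] [Fintype ι] [DecidableEq J] [Fintype J]

theorem prod_abs_innerSingle_le {α : Finset (Finset ι)} (hα : IsSetPartitionOn Finset.univ α)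
    (v : ι → ℕ) (hv : ∀ x, 1 ≤ v x) :
    ∏ s ∈ α, |innerSingle s v| ≤ (2 * 9 ^ 36) ^ α.card *
      71 ^ (Finset.univ.filter fun x => v x = 1).card * ∏ s ∈ α, ((∑ x ∈ s, v x)! : ℝ) := by
  have h : ∏ s ∈ α, (71 : ℝ) ^ (s.filter fun x => v x = 1).card =
      71 ^ (Finset.univ.filter fun x => v x = 1).card := by
    have h71 : ∀ s : Finset ι, (71 : ℝ) ^ (s.filter fun x => v x = 1).card =
        ∏ x ∈ s, if v x = 1 then (71 : ℝ) else 1 := fun s => by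
      rw [Finset.prod_ite]
      simp
    simp_rw [h71]
    exact hα.prod_prod _
  rw [← h, ← Finset.prod_const, ← Finset.prod_mul_distrib, ← Finset.prod_mul_distrib]
  exact Finset.prod_le_prod (fun _ _ => abs_nonneg _) fun s _ =>
    abs_innerSingle_le v s fun x _ => hv x

theorem abs_innerMulti_le {π : ι → J} (hπ : Function.Surjective π) (p₀ : ι) {v : ι → ℕ}
    (hv : ∀ x, 1 ≤ v x) {r : ℕ} (hr : Fintype.card ι = Fintype.card J + r)
    (hones : (Finset.univ.filter fun x => v x = 1).card ≤ 2 * r)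
    (hmax : ∀ x, v x - 1 ≤ (r + 1) * (v p₀ + 1)) {M : ℕ} (hM : ∑ x, v x = M + r) :
    |innerMulti (fiberPartition π) v| ≤
      2 * 9 ^ 36 * (2 * 9 ^ 36 * 71 ^ 2 * 336 * 16) ^ r * (M ! : ℝ) *
        ∑ p ∈ Finset.univ.filter (fun p : J → ι => ∀ j, π (p j) = j),
          ∏ x ∈ Finset.univ.filter (fun x => x ≠ p (π x)), partWeight (v x) := by
  have hterm : ∀ p ∈ sectionsThrough π p₀,
      attachSum v (sectionCompl π p₀ p) v (Finset.univ \ sectionCompl π p₀ p) ≤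
        (336 * 16) ^ r * (M ! : ℝ) *
          ∏ x ∈ Finset.univ.filter (fun x => x ≠ p (π x)), partWeight (v x) := by
    intro p hp
    rw [sectionsThrough, Finset.mem_filter] at hp
    obtain ⟨-, hp, h₀⟩ := hp
    set B := sectionCompl π p₀ p with hB
    set E := Finset.univ.filter (fun x => x ≠ p (π x)) with hE
    have hp₀E : p₀ ∉ E := by simp [hE, h₀]
    have hBE : B = insert p₀ E := by
      ext x
      simp only [hB, hE, sectionCompl, Finset.mem_filter, Finset.mem_univ, true_and,
        Finset.mem_insert]
      tauto
    have hBcard : B.card = r + 1 := by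
      have := card_sectionCompl hp h₀
      rw [← hB] at this
      omega
    have hEcard : E.card = r := by
      rw [hBE, Finset.card_insert_of_notMem hp₀E] at hBcard
      omega
    have hS : ∑ b ∈ B, (v b - 1) + 1 = v p₀ + ∑ e ∈ E, (v e - 1) := by
      rw [hBE, Finset.sum_insert hp₀E]
      have := hv p₀
      omega
    have hT : ∑ b ∈ B, (v b - 1) + 1 + ∑ x ∈ Finset.univ \ B, v x = M := by
      have h1 : ∑ b ∈ B, (v b - 1) + B.card = ∑ b ∈ B, v b := by
        rw [Finset.card_eq_sum_ones, ← Finset.sum_add_distrib]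
        exact Finset.sum_congr rfl fun b _ => Nat.sub_add_cancel (hv b)
      have h2 := Finset.sum_sdiff (f := v) (Finset.subset_univ B)
      omega
    have h1 := attachSum_le_pow hBcard (Q := Finset.univ \ B) hv
      ((Finset.card_le_card (Finset.filter_subset_filter _ (Finset.subset_univ _))).trans hones)
    rw [hT, hS] at h1
    have h2 := factorial_mul_prod_factorial_le_partWeight E v (fun e _ => hv e) (v p₀) (hv p₀)
      (by rw [hEcard]; exact fun e _ => hmax e)
    rw [hEcard] at h2
    refine h1.trans ?_
    rw [hBE, Finset.prod_insert hp₀E]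
    have hpos : (0 : ℝ) < ((v p₀ + ∑ e ∈ E, (v e - 1))! : ℝ) := by positivity
    calc (336 : ℝ) ^ r * (((v p₀)! : ℝ) * ∏ x ∈ E, ((v x)! : ℝ)) *
          ((M ! : ℝ) / ((v p₀ + ∑ e ∈ E, (v e - 1))! : ℝ))
        ≤ 336 ^ r * (16 ^ r * (∏ e ∈ E, partWeight (v e)) *
            ((v p₀ + ∑ e ∈ E, (v e - 1))! : ℝ)) *
          ((M ! : ℝ) / ((v p₀ + ∑ e ∈ E, (v e - 1))! : ℝ)) := by gcongr
      _ = _ := by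
          rw [mul_pow]
          field_simp
  have hW : ∀ p : J → ι,
      0 ≤ ∏ x ∈ Finset.univ.filter (fun x => x ≠ p (π x)), partWeight (v x) :=
    fun p => Finset.prod_nonneg fun _ _ => partWeight_nonneg _
  calc |innerMulti (fiberPartition π) v|
      ≤ ∑ α ∈ Finset.univ.filter (fun α : Finset (Finset ι) =>
          IsSetPartitionOn Finset.univ α ∧ IsComplementary (fiberPartition π) α),
          (2 * 9 ^ 36) ^ (r + 1) * 71 ^ (2 * r) * ∏ s ∈ α, ((∑ x ∈ s, v x)! : ℝ) := by
        unfold innerMulti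
        refine (Finset.abs_sum_le_sum_abs _ _).trans (Finset.sum_le_sum fun α hα => ?_)
        rw [Finset.mem_filter] at hα
        have hcard : α.card = r + 1 := by
          have h := hα.2.2.1
          rw [card_fiberPartition hπ] at h
          omega
        rw [Finset.abs_prod]
        refine (prod_abs_innerSingle_le hα.2.1 v hv).trans ?_
        rw [hcard]
        gcongr
        norm_num
    _ ≤ (2 * 9 ^ 36) ^ (r + 1) * 71 ^ (2 * r) *
          ∑ p ∈ sectionsThrough π p₀, (336 * 16) ^ r * (M ! : ℝ) *
          ∏ x ∈ Finset.univ.filter (fun x => x ≠ p (π x)), partWeight (v x) := by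
        rw [← Finset.mul_sum]
        exact mul_le_mul_of_nonneg_left ((sum_complementary_prod_factorial_le hπ p₀ v).trans
          (Finset.sum_le_sum hterm)) (by positivity)
    _ ≤ (2 * 9 ^ 36) ^ (r + 1) * 71 ^ (2 * r) *
          ∑ p ∈ Finset.univ.filter (fun p : J → ι => ∀ j, π (p j) = j),
          (336 * 16) ^ r * (M ! : ℝ) *
          ∏ x ∈ Finset.univ.filter (fun x => x ≠ p (π x)), partWeight (v x) := by
        refine mul_le_mul_of_nonneg_left (Finset.sum_le_sum_of_subset_of_nonneg ?_ ?_)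
          (by positivity)
        · intro p hp
          rw [sectionsThrough, Finset.mem_filter] at hp
          exact Finset.mem_filter.2 ⟨hp.1, hp.2.1⟩
        · intro p _ _
          exact mul_nonneg (by positivity) (hW p)
    _ = _ := by
        rw [← Finset.mul_sum, pow_mul, _root_.pow_succ']
        simp only [mul_pow]
        ring

end MultiBound

section PartitionSums

theorem sum_sections_prod_eq {n : ℕ} {β : Fin n → Type} [∀ j, Fintype (β j)]
    [∀ j, DecidableEq (β j)] (f : (Σ j, β j) → ℝ) :
    ∑ p ∈ Finset.univ.filter (fun p : Fin n → Σ j, β j => ∀ j, (p j).1 = j),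
      ∏ x ∈ Finset.univ.filter (fun x : Σ j, β j => x ≠ p x.1), f x =
    ∏ j, ∑ i : β j, ∏ t ∈ Finset.univ.filter (fun t => t ≠ i), f ⟨j, t⟩ := by
  have himg : Finset.univ.filter (fun p : Fin n → Σ j, β j => ∀ j, (p j).1 = j) =
      Finset.univ.image fun (q : ∀ j, β j) j => (⟨j, q j⟩ : Σ j, β j) := by
    ext p
    simp only [Finset.mem_filter, Finset.mem_univ, true_and, Finset.mem_image]
    constructor
    · intro h
      refine ⟨fun j => (h j) ▸ (p j).2, funext fun j => ?_⟩
      exact Sigma.ext (h j).symm (by simp)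
    · rintro ⟨q, rfl⟩ j
      rfl
  rw [himg, Finset.sum_image]
  · rw [Finset.prod_univ_sum, Fintype.piFinset_univ]
    refine Finset.sum_congr rfl fun q _ => ?_
    rw [Finset.prod_filter, Fintype.prod_sigma]
    refine Finset.prod_congr rfl fun j _ => ?_
    rw [Finset.prod_filter]
    refine Finset.prod_congr rfl fun t _ => ?_
    simp
  · intro q _ q' _ h
    funext j
    have := congrFun h j
    simpa using this

/-- The sum over the parts of `l` of the product of the weights of the other parts. -/
noncomputable def deletedWeight (l : List ℕ) : ℝ :=
  ∑ i : Fin l.length, ∏ t ∈ Finset.univ.filter (fun t => t ≠ i), partWeight (l.get t)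

theorem deletedWeight_nonneg (l : List ℕ) : 0 ≤ deletedWeight l :=
  Finset.sum_nonneg fun _ _ => Finset.prod_nonneg fun _ _ => partWeight_nonneg _

theorem deletedWeight_eq {l : List ℕ} {k : ℕ} (hl : l.length = k + 1) :
    deletedWeight l =
      ∑ i : Fin (k + 1), ∏ t : Fin k, partWeight (l.getD (i.succAbove t) 0) := by
  have h1 : deletedWeight l = ∑ i : Fin l.length,
      ∏ t ∈ Finset.univ.filter (fun t => t ≠ i), partWeight (l.getD t 0) := by
    unfold deletedWeight
    refine Finset.sum_congr rfl fun i _ => Finset.prod_congr rfl fun t _ => ?_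
    rw [List.getD_eq_getElem _ _ t.2, List.get_eq_getElem]
  have h2 : ∀ N, N = k + 1 → ∑ i : Fin N,
      ∏ t ∈ Finset.univ.filter (fun t => t ≠ i), partWeight (l.getD t 0) =
      ∑ i : Fin (k + 1), ∏ t : Fin k, partWeight (l.getD (i.succAbove t) 0) := by
    rintro _ rfl
    refine Finset.sum_congr rfl fun i _ => ?_
    have : Finset.univ.filter (fun t => t ≠ i) = Finset.univ.image i.succAbove := by
      rw [Fin.image_succAbove_univ]
      ext t
      simp
    rw [this, Finset.prod_image (Fin.succAbove_right_injective.injOn)]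
  rw [h1, h2 _ hl]

theorem one_le_of_mem_partitionsOfWeight {w : ℕ} {s : Multiset ℕ}
    (hs : s ∈ partitionsOfWeight w) {c : ℕ} (hc : c ∈ s) : 1 ≤ c := by
  obtain ⟨μ, hμ, rfl⟩ := Finset.mem_image.1 hs
  obtain ⟨p, hp, rfl⟩ := Multiset.mem_map.1 hc
  have := (Finset.mem_filter.1 hμ).2 p hp
  omega

theorem sum_add_card_of_mem_partitionsOfWeight {w : ℕ} {s : Multiset ℕ}
    (hs : s ∈ partitionsOfWeight w) : s.sum + Multiset.card s = w := by
  obtain ⟨μ, hμ, rfl⟩ := Finset.mem_image.1 hs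
  have h2 := (Finset.mem_filter.1 hμ).2
  have h : (μ.parts.map fun p => p - 1).sum + Multiset.card μ.parts = μ.parts.sum := by
    have : ∀ t : Multiset ℕ, (∀ p ∈ t, 2 ≤ p) →
        (t.map fun p => p - 1).sum + Multiset.card t = t.sum := by
      intro t
      induction t using Multiset.induction_on with
      | empty => simp
      | cons a t ih =>
        intro ht
        have h1 := ih fun p hp => ht p (Multiset.mem_cons_of_mem hp)
        have h2 := ht a (Multiset.mem_cons_self a t)
        simp only [Multiset.map_cons, Multiset.sum_cons, Multiset.card_cons]
        omega
    exact this _ h2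
  rw [Multiset.card_map, h, μ.parts_sum]

theorem coe_eq_cons_map_succAbove {l : List ℕ} {k : ℕ} (hl : l.length = k + 1)
    (i : Fin (k + 1)) :
    (l : Multiset ℕ) = l.getD i 0 ::ₘ
      (Finset.univ : Finset (Fin k)).val.map fun t : Fin k => l.getD (i.succAbove t) 0 := by
  have h1 : (l : Multiset ℕ) =
      (Finset.univ : Finset (Fin (k + 1))).val.map fun t : Fin (k + 1) => l.getD t 0 := by
    have h3 : ∀ N, l.length = N → (l : Multiset ℕ) =
        (Finset.univ : Finset (Fin N)).val.map fun t : Fin N => l.getD t 0 := by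
      rintro _ rfl
      rw [Fin.univ_val_map]
      congr 1
      refine List.ext_get (by simp) fun a h1 h2 => ?_
      simp
    exact h3 _ hl
  rw [h1, Fin.univ_succAbove k i]
  simp only [Finset.cons_val, Multiset.map_cons, Finset.map_val, Multiset.map_map]
  rfl

theorem sum_prod_partWeight_succAbove_le (m : ℕ) {k : ℕ} (i : Fin (k + 1)) :
    ∑ s ∈ (partitionsOfWeight (m + 1)).filter (fun s => Multiset.card s = k + 1),
      ∏ t : Fin k, partWeight (s.toList.getD (i.succAbove t) 0) ≤ 3 ^ k := by
  set A := (partitionsOfWeight (m + 1)).filter (fun s => Multiset.card s = k + 1) with hA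
  have hlen : ∀ s ∈ A, s.toList.length = k + 1 := fun s hs => by
    rw [Multiset.length_toList]
    exact (Finset.mem_filter.1 hs).2
  have hle : ∀ s ∈ A, ∀ c ∈ s, c ∈ Finset.Icc 1 m := by
    intro s hs c hc
    have hs' := (Finset.mem_filter.1 hs)
    have h1 := one_le_of_mem_partitionsOfWeight hs'.1 hc
    have h2 := sum_add_card_of_mem_partitionsOfWeight hs'.1
    have h3 := Multiset.single_le_sum (fun _ _ => Nat.zero_le _) c hc
    rw [Finset.mem_Icc]
    omega
  set del : Multiset ℕ → (Fin k → ℕ) := fun s t => s.toList.getD (i.succAbove t) 0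
  have hinj : Set.InjOn del (A : Set (Multiset ℕ)) := by
    intro s hs s' hs' h
    have e := coe_eq_cons_map_succAbove (hlen s hs) i
    have e' := coe_eq_cons_map_succAbove (hlen s' hs') i
    have hu : (fun t => s.toList.getD (i.succAbove t) 0) =
      fun t => s'.toList.getD (i.succAbove t) 0 := h
    rw [Multiset.coe_toList] at e e'
    rw [hu] at e
    have hw := sum_add_card_of_mem_partitionsOfWeight (Finset.mem_filter.1 hs).1
    have hw' := sum_add_card_of_mem_partitionsOfWeight (Finset.mem_filter.1 hs').1
    rw [(Finset.mem_filter.1 hs).2, e, Multiset.sum_cons] at hw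
    rw [(Finset.mem_filter.1 hs').2, e', Multiset.sum_cons] at hw'
    refine e.trans (Eq.trans ?_ e'.symm)
    rw [show s.toList.getD i 0 = s'.toList.getD i 0 by omega]
  have himg : A.image del ⊆ Fintype.piFinset fun _ : Fin k => Finset.Icc 1 m := by
    intro u hu
    obtain ⟨s, hs, rfl⟩ := Finset.mem_image.1 hu
    refine Fintype.mem_piFinset.2 fun t => hle s hs _ ?_
    have hlt : (i.succAbove t : ℕ) < s.toList.length := by
      rw [hlen s hs]
      exact (i.succAbove t).2
    change s.toList.getD (i.succAbove t) 0 ∈ s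
    rw [List.getD_eq_getElem _ _ hlt, ← Multiset.mem_toList]
    exact List.getElem_mem hlt
  calc ∑ s ∈ A, ∏ t : Fin k, partWeight (del s t)
      = ∑ u ∈ A.image del, ∏ t : Fin k, partWeight (u t) :=
        (Finset.sum_image (f := fun u : Fin k → ℕ => ∏ t : Fin k, partWeight (u t)) hinj).symm
    _ ≤ ∑ u ∈ Fintype.piFinset fun _ : Fin k => Finset.Icc 1 m,
          ∏ t : Fin k, partWeight (u t) :=
        Finset.sum_le_sum_of_subset_of_nonneg himg
          fun _ _ _ => Finset.prod_nonneg fun _ _ => partWeight_nonneg _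
    _ = (∑ c ∈ Finset.Icc 1 m, partWeight c) ^ k := by
        rw [← Finset.prod_univ_sum (fun _ : Fin k => Finset.Icc 1 m) fun _ c => partWeight c,
          Finset.prod_const, Finset.card_univ, Fintype.card_fin]
    _ ≤ 3 ^ k := pow_le_pow_left₀ (Finset.sum_nonneg fun _ _ => partWeight_nonneg _)
          (sum_Icc_partWeight_le m) k

theorem sum_deletedWeight_le (m k : ℕ) :
    ∑ s ∈ (partitionsOfWeight (m + 1)).filter (fun s => Multiset.card s = k + 1),
      deletedWeight s.toList ≤ (k + 1) * 3 ^ k := by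
  calc ∑ s ∈ (partitionsOfWeight (m + 1)).filter (fun s => Multiset.card s = k + 1),
        deletedWeight s.toList
      = ∑ s ∈ (partitionsOfWeight (m + 1)).filter (fun s => Multiset.card s = k + 1),
          ∑ i : Fin (k + 1), ∏ t : Fin k, partWeight (s.toList.getD (i.succAbove t) 0) :=
        Finset.sum_congr rfl fun s hs => deletedWeight_eq <| by
          rw [Multiset.length_toList]
          exact (Finset.mem_filter.1 hs).2
    _ ≤ ∑ _i : Fin (k + 1), (3 : ℝ) ^ k := by
        rw [Finset.sum_comm]
        exact Finset.sum_le_sum fun i _ => sum_prod_partWeight_succAbove_le m i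
    _ = _ := by simp

theorem succ_mul_three_pow_le (k : ℕ) : ((k : ℝ) + 1) * 3 ^ k ≤ 6 ^ k := by
  have h : (k : ℝ) + 1 ≤ 2 ^ k := by exact_mod_cast Nat.lt_two_pow_self
  calc ((k : ℝ) + 1) * 3 ^ k ≤ 2 ^ k * 3 ^ k := by gcongr
    _ = 6 ^ k := by rw [← mul_pow]; norm_num

theorem sum_deletedWeight_mul_pow_div_factorial_le (m : ℕ) {x : ℝ} (hx : 0 ≤ x) :
    ∑ s ∈ partitionsOfWeight (m + 1), x ^ (Multiset.card s - 1) /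
      ((Multiset.card s - 1)! : ℝ) * deletedWeight s.toList ≤ Real.exp (6 * x) := by
  have hmaps : ∀ s ∈ partitionsOfWeight (m + 1),
      Multiset.card s - 1 ∈ Finset.range (m + 1) := by
    intro s hs
    have := sum_add_card_of_mem_partitionsOfWeight hs
    rw [Finset.mem_range]
    omega
  have hpos : ∀ s ∈ partitionsOfWeight (m + 1), 1 ≤ Multiset.card s := by
    intro s hs
    have := sum_add_card_of_mem_partitionsOfWeight hs
    rcases Nat.eq_zero_or_pos (Multiset.card s) with h | h
    · rw [Multiset.card_eq_zero] at h
      simp [h] at this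
    · exact h
  rw [← Finset.sum_fiberwise_of_maps_to hmaps]
  refine le_trans (Finset.sum_le_sum fun k _ => ?_)
    (Real.sum_le_exp_of_nonneg (by positivity : 0 ≤ 6 * x) (m + 1))
  have hfilter : (partitionsOfWeight (m + 1)).filter (fun s => Multiset.card s - 1 = k) =
      (partitionsOfWeight (m + 1)).filter (fun s => Multiset.card s = k + 1) := by
    refine Finset.filter_congr fun s hs => ?_
    have := hpos s hs
    omega
  rw [hfilter]
  calc ∑ s ∈ (partitionsOfWeight (m + 1)).filter (fun s => Multiset.card s = k + 1),
        x ^ (Multiset.card s - 1) / ((Multiset.card s - 1)! : ℝ) * deletedWeight s.toList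
      = x ^ k / (k ! : ℝ) *
        ∑ s ∈ (partitionsOfWeight (m + 1)).filter (fun s => Multiset.card s = k + 1),
          deletedWeight s.toList := by
        rw [Finset.mul_sum]
        refine Finset.sum_congr rfl fun s hs => ?_
        rw [(Finset.mem_filter.1 hs).2, Nat.add_sub_cancel]
    _ ≤ x ^ k / (k ! : ℝ) * 6 ^ k := by
        gcongr
        exact (sum_deletedWeight_le m k).trans (succ_mul_three_pow_le k)
    _ = (6 * x) ^ k / (k ! : ℝ) := by
        rw [mul_pow]
        ring

theorem factorial_mul_factorial_succ_le {a : ℕ} (ha : 1 ≤ a) (b : ℕ) :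
    a ! * (b + 1)! ≤ (a + b)! := by
  induction b with
  | zero => simp
  | succ b ih =>
    rw [Nat.factorial_succ (b + 1), ← add_assoc, Nat.factorial_succ (a + b)]
    calc a ! * ((b + 1 + 1) * (b + 1)!) = (b + 1 + 1) * (a ! * (b + 1)!) := by ring
      _ ≤ (a + b + 1) * (a + b)! := Nat.mul_le_mul (by omega) ih

theorem pow_mul_factorial_mul_factorial_le {N r : ℕ} (hr : 1 ≤ r) (hN : 2 * r + 1 ≤ N) :
    N ^ r * ((N - 2 * r)! * r !) ≤ 2 ^ r * (N - 1)! := by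
  have h1 : (N - 2 * r)! * r ! ≤ (N - 1 - r)! := by
    have := factorial_mul_factorial_succ_le (a := N - 2 * r) (by omega) (r - 1)
    rwa [Nat.sub_add_cancel hr, show N - 2 * r + (r - 1) = N - 1 - r by omega] at this
  have h2 := Nat.factorial_mul_pow_le_factorial (m := N - 1 - r) (n := r)
  rw [show N - 1 - r + r = N - 1 by omega] at h2
  have h3 : N ^ r ≤ 2 ^ r * (N - 1 - r + 1) ^ r := by
    rw [← mul_pow]
    exact Nat.pow_le_pow_left (by omega) r
  calc N ^ r * ((N - 2 * r)! * r !) ≤ 2 ^ r * (N - 1 - r + 1) ^ r * (N - 1 - r)! :=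
        Nat.mul_le_mul h3 h1
    _ = 2 ^ r * ((N - 1 - r)! * (N - 1 - r + 1) ^ r) := by ring
    _ ≤ _ := Nat.mul_le_mul_left _ h2

end PartitionSums

section Tuples

theorem innerMulti_eq_innerSingle {ι J : Type*} [DecidableEq ι] [Fintype ι] [DecidableEq J]
    [Fintype J] [Nonempty ι] {π : ι → J} (hπ : Function.Surjective π)
    (hcard : Fintype.card ι = Fintype.card J) (v : ι → ℕ) :
    innerMulti (fiberPartition π) v = innerSingle Finset.univ v := by
  have h : Finset.univ.filter (fun α : Finset (Finset ι) =>
      IsSetPartitionOn Finset.univ α ∧ IsComplementary (fiberPartition π) α) =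
      {{Finset.univ}} := by
    ext α
    simp only [Finset.mem_filter, Finset.mem_univ, true_and, Finset.mem_singleton]
    constructor
    · rintro ⟨hα, hc, -⟩
      rw [card_fiberPartition hπ] at hc
      obtain ⟨s, rfl⟩ := Finset.card_eq_one.1 (by omega : α.card = 1)
      rw [Finset.singleton_inj, Finset.eq_univ_iff_forall]
      intro x
      obtain ⟨t, ⟨ht, hx⟩, -⟩ := hα.2 x (Finset.mem_univ _)
      rwa [Finset.mem_singleton.1 ht] at hx
    · rintro rfl
      refine ⟨⟨fun s hs => ?_, fun x _ => ⟨Finset.univ, by simp, fun t ht => ?_⟩⟩, ?_, ?_⟩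
      · rw [Finset.mem_singleton.1 hs]
        exact ⟨Finset.subset_univ _, Finset.univ_nonempty.ne_empty⟩
      · exact Finset.mem_singleton.1 ht.1
      · rw [card_fiberPartition hπ, Finset.card_singleton, hcard]
      · intro γ hγ _ hr
        obtain ⟨t, ht, hst⟩ := hr Finset.univ (Finset.mem_singleton_self _)
        rw [Finset.univ_subset_iff] at hst
        exact hγ.eq_singleton (hst ▸ ht)
  rw [innerMulti, h, Finset.sum_singleton, Finset.prod_singleton]

variable {m : ℕ} {s : Multiset ℕ}

theorem card_pos_of_mem_partitionsOfWeight (hs : s ∈ partitionsOfWeight (m + 1)) :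
    1 ≤ Multiset.card s := by
  have := sum_add_card_of_mem_partitionsOfWeight hs
  rcases Nat.eq_zero_or_pos (Multiset.card s) with h | h
  · rw [Multiset.card_eq_zero] at h
    simp [h] at this
  · exact h

theorem two_mul_card_le_of_mem_partitionsOfWeight (hs : s ∈ partitionsOfWeight (m + 1)) :
    2 * Multiset.card s ≤ m + 1 := by
  have h1 := sum_add_card_of_mem_partitionsOfWeight hs
  have h2 := Multiset.card_nsmul_le_sum (s := s) (a := 1)
    fun c hc => one_le_of_mem_partitionsOfWeight hs hc
  rw [smul_eq_mul] at h2
  omega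

theorem eq_singleton_of_mem_partitionsOfWeight (hs : s ∈ partitionsOfWeight (m + 1))
    (hc : Multiset.card s = 1) : s = {m} := by
  obtain ⟨a, rfl⟩ := Multiset.card_eq_one.1 hc
  have := sum_add_card_of_mem_partitionsOfWeight hs
  simp only [Multiset.sum_singleton, Multiset.card_singleton] at this
  rw [Multiset.singleton_inj]
  omega

theorem singleton_mem_partitionsOfWeight (hm : 1 ≤ m) :
    ({m} : Multiset ℕ) ∈ partitionsOfWeight (m + 1) := by
  refine Finset.mem_image.2 ⟨Nat.Partition.indiscrete (m + 1), ?_, ?_⟩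
  · rw [Finset.mem_filter]
    refine ⟨Finset.mem_univ _, fun p hp => ?_⟩
    rw [Nat.Partition.indiscrete_parts (by omega), Multiset.mem_singleton] at hp
    omega
  · rw [Nat.Partition.indiscrete_parts (by omega), Multiset.map_singleton, Nat.add_sub_cancel]

theorem card_filter_get_eq_one_le (hs : s ∈ partitionsOfWeight (m + 1)) (hm : 2 ≤ m) :
    (Finset.univ.filter fun i : Fin s.toList.length => s.toList.get i = 1).card ≤
      2 * (Multiset.card s - 1) := by
  have h1 := card_pos_of_mem_partitionsOfWeight hs
  rcases h1.eq_or_lt with h | h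
  · have hsm := eq_singleton_of_mem_partitionsOfWeight hs h.symm
    rw [Finset.card_eq_zero.2, ← h]
    rw [Finset.filter_eq_empty_iff]
    intro i _ hi
    have : s.toList.get i ∈ s := Multiset.mem_toList.1 (List.get_mem _ _)
    rw [hi, hsm, Multiset.mem_singleton] at this
    omega
  · have := Finset.card_le_univ
      (Finset.univ.filter fun i : Fin s.toList.length => s.toList.get i = 1)
    have hl := Multiset.length_toList s
    rw [Fintype.card_fin] at this
    omega

theorem sum_get_toList (s : Multiset ℕ) :
    ∑ i : Fin s.toList.length, s.toList.get i = s.sum := by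
  rw [← Multiset.sum_toList, ← List.sum_ofFn, List.ofFn_get]

variable {n : ℕ} {T : Fin n → Multiset ℕ} {m : Fin n → ℕ}

theorem surjective_fst_of_card_pos (h : ∀ j, 1 ≤ Multiset.card (T j)) :
    Function.Surjective (Sigma.fst : (Σ j : Fin n, Fin (T j).toList.length) → Fin n) :=
  fun j => ⟨⟨j, ⟨0, by rw [Multiset.length_toList]; exact h j⟩⟩, rfl⟩

theorem card_sigma_length (h : ∀ j, 1 ≤ Multiset.card (T j)) :
    Fintype.card (Σ j : Fin n, Fin (T j).toList.length) =
      Fintype.card (Fin n) + ∑ j, (Multiset.card (T j) - 1) := by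
  rw [Fintype.card_sigma, ← Finset.card_univ, Finset.card_eq_sum_ones, ← Finset.sum_add_distrib]
  refine Finset.sum_congr rfl fun j _ => ?_
  have := h j
  rw [Fintype.card_fin, Multiset.length_toList]
  omega

theorem abs_innerMulti_tuple_le [NeZero n] (hm : ∀ j, 2 ≤ m j) (hmax : ∀ j, m j ≤ m 0)
    (hT : ∀ j, T j ∈ partitionsOfWeight (m j + 1)) {r : ℕ}
    (hr : ∑ j, (Multiset.card (T j) - 1) = r) :
    |innerMulti (fiberPartition (Sigma.fst : (Σ j : Fin n, Fin (T j).toList.length) → Fin n))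
      (fun x => (T x.1).toList.get x.2)| ≤
      2 * 9 ^ 36 * (2 * 9 ^ 36 * 71 ^ 2 * 336 * 16) ^ r * ((∑ j, m j - 2 * r)! : ℝ) *
        ∏ j, deletedWeight (T j).toList := by
  have hpos : ∀ j, 1 ≤ Multiset.card (T j) := fun j => card_pos_of_mem_partitionsOfWeight (hT j)
  have hmem : ∀ x : Σ j : Fin n, Fin (T j).toList.length, (T x.1).toList.get x.2 ∈ T x.1 :=
    fun x => Multiset.mem_toList.1 (List.get_mem _ _)
  have h2r : 2 * r ≤ ∑ j, m j := by
    rw [← hr, Finset.mul_sum]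
    refine Finset.sum_le_sum fun j _ => ?_
    have := two_mul_card_le_of_mem_partitionsOfWeight (hT j)
    omega
  have hsum : ∑ x : Σ j : Fin n, Fin (T j).toList.length, (T x.1).toList.get x.2 =
      ∑ j, m j - 2 * r + r := by
    have h1 : ∑ x : Σ j : Fin n, Fin (T j).toList.length, (T x.1).toList.get x.2 + r =
        ∑ j, m j := by
      rw [Fintype.sum_sigma, ← hr, ← Finset.sum_add_distrib]
      refine Finset.sum_congr rfl fun j _ => ?_
      have h2 := sum_add_card_of_mem_partitionsOfWeight (hT j)
      have h3 := hpos j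
      have h4 := sum_get_toList (T j)
      simp only
      omega
    omega
  have hones : (Finset.univ.filter fun x : Σ j : Fin n, Fin (T j).toList.length =>
      (T x.1).toList.get x.2 = 1).card ≤ 2 * r := by
    rw [Finset.card_filter, Fintype.sum_sigma, ← hr, Finset.mul_sum]
    refine Finset.sum_le_sum fun j _ => ?_
    have := card_filter_get_eq_one_le (hT j) (hm j)
    rwa [Finset.card_filter] at this
  have hne : (Finset.univ : Finset (Fin (T 0).toList.length)).Nonempty :=
    ⟨⟨0, by rw [Multiset.length_toList]; exact hpos 0⟩, Finset.mem_univ _⟩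
  obtain ⟨i₀, -, hi₀⟩ := Finset.exists_max_image Finset.univ (fun i => (T 0).toList.get i) hne
  have hbig : ∀ x : Σ j : Fin n, Fin (T j).toList.length,
      (T x.1).toList.get x.2 - 1 ≤ (r + 1) * ((T 0).toList.get i₀ + 1) := by
    intro x
    have h1 : (T x.1).toList.get x.2 ≤ (T x.1).sum :=
      Multiset.single_le_sum (fun _ _ => Nat.zero_le _) _ (hmem x)
    have h2 := sum_add_card_of_mem_partitionsOfWeight (hT x.1)
    have h3 := hpos x.1
    have h4 := hmax x.1
    have h5 := sum_add_card_of_mem_partitionsOfWeight (hT 0)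
    have h6 : (T 0).sum ≤ Multiset.card (T 0) * (T 0).toList.get i₀ := by
      rw [← sum_get_toList]
      refine (Finset.sum_le_card_nsmul _ _ _ fun i _ => hi₀ i (Finset.mem_univ _)).trans ?_
      rw [Finset.card_univ, Fintype.card_fin, Multiset.length_toList, smul_eq_mul]
    have h7 : Multiset.card (T 0) ≤ r + 1 := by
      have := Finset.single_le_sum (f := fun j => Multiset.card (T j) - 1)
        (fun _ _ => Nat.zero_le _) (Finset.mem_univ (0 : Fin n))
      simp only [hr] at this
      omega
    have h8 : Multiset.card (T 0) * ((T 0).toList.get i₀ + 1) ≤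
        (r + 1) * ((T 0).toList.get i₀ + 1) := Nat.mul_le_mul_right _ h7
    rw [mul_add, mul_one] at h8
    omega
  refine (abs_innerMulti_le (surjective_fst_of_card_pos hpos) ⟨0, i₀⟩
    (fun x => one_le_of_mem_partitionsOfWeight (hT x.1) (hmem x))
    (by rw [card_sigma_length hpos, hr]) hones hbig hsum).trans (le_of_eq ?_)
  congr 1
  refine Eq.trans ?_ ((sum_sections_prod_eq fun x : Σ j : Fin n, Fin (T j).toList.length =>
    partWeight ((T x.1).toList.get x.2)).trans (Finset.prod_congr rfl fun j _ => ?_))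
  · congr!
  · unfold deletedWeight
    congr!

theorem abs_prod_coeff_le (T : Fin n → Multiset ℕ) (m : Fin n → ℕ) :
    |∏ j, ((-(m j : ℝ)) ^ (Multiset.card (T j) - 1) /
        ∏ i ∈ (T j).toFinset, (((T j).count i)! : ℝ))| ≤
      ∏ j, (m j : ℝ) ^ (Multiset.card (T j) - 1) := by
  rw [Finset.abs_prod]
  refine Finset.prod_le_prod (fun _ _ => abs_nonneg _) fun j _ => ?_
  rw [abs_div, abs_pow, abs_neg, Nat.abs_cast]
  have h : (1 : ℝ) ≤ |∏ i ∈ (T j).toFinset, (((T j).count i)! : ℝ)| := by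
    have h1 : 1 ≤ ∏ i ∈ (T j).toFinset, ((T j).count i)! :=
      Finset.one_le_prod' fun i _ => Nat.factorial_pos _
    refine le_trans ?_ (le_abs_self _)
    exact_mod_cast h1
  exact div_le_self (by positivity) h

theorem abs_summand_le [NeZero n] (hm : ∀ j, 2 ≤ m j) (hmax : ∀ j, m j ≤ m 0)
    (hT : ∀ j, T j ∈ partitionsOfWeight (m j + 1)) (hne : T ≠ fun j => {m j}) :
    |innerMulti (fiberPartition (Sigma.fst : (Σ j : Fin n, Fin (T j).toList.length) → Fin n))
      (fun x => (T x.1).toList.get x.2) *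
      ∏ j, ((-(m j : ℝ)) ^ (Multiset.card (T j) - 1) /
        ∏ i ∈ (T j).toFinset, (((T j).count i)! : ℝ))| ≤
      2 * 9 ^ 36 * ((∑ j, m j - 1)! : ℝ) *
        ∏ j, ((2 * (2 * 9 ^ 36 * 71 ^ 2 * 336 * 16) * (m j : ℝ) / (∑ j, m j : ℕ)) ^
          (Multiset.card (T j) - 1) / ((Multiset.card (T j) - 1)! : ℝ) *
            deletedWeight (T j).toList) := by
  obtain ⟨r, hr⟩ : ∃ r, ∑ j, (Multiset.card (T j) - 1) = r := ⟨_, rfl⟩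
  have hr1 : 1 ≤ r := by
    by_contra h
    refine hne (funext fun j => eq_singleton_of_mem_partitionsOfWeight (hT j) ?_)
    have h0 : ∑ j, (Multiset.card (T j) - 1) = 0 := by omega
    have h1 := (Finset.sum_eq_zero_iff.1 h0) j (Finset.mem_univ _)
    have h2 := card_pos_of_mem_partitionsOfWeight (hT j)
    omega
  have h2r : 2 * r + 1 ≤ ∑ j, m j := by
    have h : ∑ j, (2 * (Multiset.card (T j) - 1) + 1) ≤ ∑ j, m j := by
      refine Finset.sum_le_sum fun j _ => ?_
      have h1 := two_mul_card_le_of_mem_partitionsOfWeight (hT j)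
      have h2 := card_pos_of_mem_partitionsOfWeight (hT j)
      omega
    rw [Finset.sum_add_distrib, ← Finset.mul_sum, hr] at h
    have hn := Nat.pos_of_ne_zero (NeZero.ne n)
    simp only [Finset.sum_const, Finset.card_univ, Fintype.card_fin, smul_eq_mul, mul_one] at h
    omega
  have h1 := abs_innerMulti_tuple_le hm hmax hT hr
  have h2 := abs_prod_coeff_le T m
  generalize hK : (2 * 9 ^ 36 * 71 ^ 2 * 336 * 16 : ℝ) = K at h1 ⊢
  have hK0 : 0 < K := by rw [← hK]; norm_num
  generalize hD : (2 * 9 ^ 36 : ℝ) = D at h1 ⊢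
  have hD0 : 0 < D := by rw [← hD]; norm_num
  set N := ∑ j, m j with hN
  have hN0 : (0 : ℝ) < N := by
    have : 0 < N := by omega
    exact_mod_cast this
  set P := ∏ j, (m j : ℝ) ^ (Multiset.card (T j) - 1) with hP
  set Y := ∏ j, deletedWeight (T j).toList with hY
  set G := ∏ j, ((Multiset.card (T j) - 1)! : ℝ) with hG
  have hG0 : 0 < G := Finset.prod_pos fun _ _ => by positivity
  have hY0 : 0 ≤ Y := Finset.prod_nonneg fun _ _ => deletedWeight_nonneg _
  have hP0 : 0 ≤ P := Finset.prod_nonneg fun _ _ => by positivity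
  have hGr : G ≤ (r ! : ℝ) := by
    have := Nat.le_of_dvd (Nat.factorial_pos _)
      (Nat.prod_factorial_dvd_factorial_sum Finset.univ fun j => Multiset.card (T j) - 1)
    rw [hr] at this
    rw [hG]
    exact_mod_cast this
  have h3 : (N : ℝ) ^ r * (((N - 2 * r)! : ℝ) * G) ≤ 2 ^ r * ((N - 1)! : ℝ) := by
    have h4 := pow_mul_factorial_mul_factorial_le hr1 h2r
    calc (N : ℝ) ^ r * (((N - 2 * r)! : ℝ) * G)
        ≤ (N : ℝ) ^ r * (((N - 2 * r)! : ℝ) * (r ! : ℝ)) := by gcongr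
      _ ≤ _ := by exact_mod_cast h4
  have hR : ∏ j, ((2 * K * (m j : ℝ) / (N : ℝ)) ^ (Multiset.card (T j) - 1) /
      ((Multiset.card (T j) - 1)! : ℝ) * deletedWeight (T j).toList) =
      (2 * K / N) ^ r * P / G * Y := by
    have h4 : ∏ j, (2 * K * (m j : ℝ) / (N : ℝ)) ^ (Multiset.card (T j) - 1) =
        (2 * K / N) ^ r * P := by
      rw [← hr, ← Finset.prod_pow_eq_pow_sum, hP, ← Finset.prod_mul_distrib]
      refine Finset.prod_congr rfl fun j _ => ?_
      rw [← mul_pow, mul_div_right_comm]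
    rw [Finset.prod_mul_distrib, Finset.prod_div_distrib, h4]
  rw [hR, abs_mul]
  have h5 : ((N - 2 * r)! : ℝ) ≤ 2 ^ r * ((N - 1)! : ℝ) / ((N : ℝ) ^ r * G) := by
    rw [le_div_iff₀ (by positivity)]
    calc _ = (N : ℝ) ^ r * (((N - 2 * r)! : ℝ) * G) := by ring
      _ ≤ _ := h3
  calc _ ≤ (D * K ^ r * ((N - 2 * r)! : ℝ) * Y) * P := by
        exact mul_le_mul h1 h2 (abs_nonneg _) (by positivity)
    _ ≤ (D * K ^ r * (2 ^ r * ((N - 1)! : ℝ) / ((N : ℝ) ^ r * G)) * Y) * P := by gcongr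
    _ = _ := by
        rw [div_pow, mul_pow]
        field_simp

end Tuples

section Main

theorem innerF_eq_sum {n : ℕ} (m : Fin n → ℕ) :
    innerF m = ∑ T ∈ Fintype.piFinset fun j : Fin n => partitionsOfWeight (m j + 1),
      innerMulti (fiberPartition (Sigma.fst : (Σ j : Fin n, Fin (T j).toList.length) → Fin n))
        (fun x => (T x.1).toList.get x.2) *
      ∏ j, ((-(m j : ℝ)) ^ (Multiset.card (T j) - 1) /
        ∏ i ∈ (T j).toFinset, (((T j).count i)! : ℝ)) := by
  unfold innerF fiberPartition
  congr!

theorem sum_prod_deletedWeight_le {n : ℕ} [NeZero n] {m : Fin n → ℕ} (hm : ∀ j, 2 ≤ m j) {K : ℝ}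
    (hK : 0 ≤ K) :
    ∑ T ∈ Fintype.piFinset fun j : Fin n => partitionsOfWeight (m j + 1),
      ∏ j, ((2 * K * (m j : ℝ) / (∑ j, m j : ℕ)) ^ (Multiset.card (T j) - 1) /
        ((Multiset.card (T j) - 1)! : ℝ) * deletedWeight (T j).toList) ≤ Real.exp (12 * K) := by
  have hN : (0 : ℝ) < (∑ j, m j : ℕ) := by
    have h : m 0 ≤ ∑ j, m j := Finset.single_le_sum (fun _ _ => Nat.zero_le _) (Finset.mem_univ _)
    have : 0 < ∑ j, m j := by have := hm 0; omega
    exact_mod_cast this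
  rw [← Finset.prod_univ_sum (fun j : Fin n => partitionsOfWeight (m j + 1)) fun j s =>
    (2 * K * (m j : ℝ) / (∑ j, m j : ℕ)) ^ (Multiset.card s - 1) /
        ((Multiset.card s - 1)! : ℝ) * deletedWeight s.toList]
  calc _ ≤ ∏ j, Real.exp (6 * (2 * K * (m j : ℝ) / (∑ j, m j : ℕ))) := by
        refine Finset.prod_le_prod (fun j _ => Finset.sum_nonneg fun s _ => ?_) fun j _ =>
          sum_deletedWeight_mul_pow_div_factorial_le (m j) (by positivity)
        exact mul_nonneg (by positivity) (deletedWeight_nonneg _)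
    _ = Real.exp (12 * K) := by
        rw [← Real.exp_sum, ← Finset.mul_sum, ← Finset.sum_div, ← Finset.mul_sum]
        push_cast at hN ⊢
        rw [mul_div_assoc, div_self hN.ne']
        congr 1
        ring

theorem exp_natCast_le_two_pow (c : ℕ) : Real.exp (c : ℝ) ≤ 2 ^ (2 * c) := by
  have h : Real.exp 1 ≤ 2 ^ 2 := by
    have := Real.exp_one_lt_d9
    norm_num at this ⊢
    linarith
  rw [← Real.exp_one_pow, pow_mul]
  exact pow_le_pow_left₀ (Real.exp_pos _).le h c

theorem add_mul_exp_le_two_pow {a b : ℕ} (hab : 2 ^ 150 = a) (h : a + 121 ≤ b) :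
    (56 * 9 ^ 36 : ℝ) + 2 * 9 ^ 36 * Real.exp (12 * (2 * 9 ^ 36 * 71 ^ 2 * 336 * 16)) ≤ 2 ^ b := by
  have h1 : Real.exp (12 * (2 * 9 ^ 36 * 71 ^ 2 * 336 * 16)) ≤ 2 ^ a := by
    have h2 : (12 * (2 * 9 ^ 36 * 71 ^ 2 * 336 * 16) : ℝ) =
        (12 * (2 * 9 ^ 36 * 71 ^ 2 * 336 * 16) : ℕ) := by norm_num
    rw [h2]
    refine (exp_natCast_le_two_pow _).trans (pow_le_pow_right₀ (by norm_num) ?_)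
    rw [← hab]
    norm_num
  have h3 : (1 : ℝ) ≤ 2 ^ a := one_le_pow₀ (by norm_num)
  calc (56 * 9 ^ 36 : ℝ) + 2 * 9 ^ 36 * Real.exp (12 * (2 * 9 ^ 36 * 71 ^ 2 * 336 * 16))
      ≤ 56 * 9 ^ 36 * 2 ^ a + 2 * 9 ^ 36 * 2 ^ a := by
        refine add_le_add (le_mul_of_one_le_right (by positivity) h3) ?_
        exact mul_le_mul_of_nonneg_left h1 (by positivity)
    _ = (58 * 9 ^ 36) * 2 ^ a := by ring
    _ ≤ 2 ^ 121 * 2 ^ a := mul_le_mul_of_nonneg_right (by norm_num) (by positivity)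
    _ = 2 ^ (a + 121) := by rw [← pow_add, add_comm]
    _ ≤ 2 ^ b := pow_le_pow_right₀ (by norm_num) h

theorem abs_main_summand_sub_le {n : ℕ} [NeZero n] {m : Fin n → ℕ} (hm : ∀ j, 2 ≤ m j)
    {T : Fin n → Multiset ℕ} (hT : T = fun j => {m j}) :
    |innerMulti (fiberPartition (Sigma.fst : (Σ j : Fin n, Fin (T j).toList.length) → Fin n))
        (fun x => (T x.1).toList.get x.2) *
      ∏ j, ((-(m j : ℝ)) ^ (Multiset.card (T j) - 1) /
        ∏ i ∈ (T j).toFinset, (((T j).count i)! : ℝ)) -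
      ((∑ j, m j)! : ℝ) * zed ((∑ j, m j : ℤ) - n + 2)| ≤
      56 * 9 ^ 36 * ((∑ j, m j - 1)! : ℝ) := by
  have hcard : ∀ j, Multiset.card (T j) = 1 := fun j => by rw [hT]; simp
  have hcoeff : ∏ j, ((-(m j : ℝ)) ^ (Multiset.card (T j) - 1) /
        ∏ i ∈ (T j).toFinset, (((T j).count i)! : ℝ)) = 1 := by
    refine Finset.prod_eq_one fun j _ => ?_
    rw [hcard, hT]
    simp
  have hcι : Fintype.card (Σ j : Fin n, Fin (T j).toList.length) = n := by
    rw [card_sigma_length fun j => (hcard j).ge]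
    simp [hcard]
  have hsurj := surjective_fst_of_card_pos (T := T) fun j => (hcard j).ge
  have hval : ∀ x : Σ j : Fin n, Fin (T j).toList.length, (T x.1).toList.get x.2 = m x.1 := by
    intro x
    have : (T x.1).toList.get x.2 ∈ T x.1 := Multiset.mem_toList.1 (List.get_mem _ _)
    generalize (T x.1).toList.get x.2 = c at this ⊢
    rw [show T x.1 = {m x.1} from congrFun hT x.1] at this
    exact Multiset.mem_singleton.1 this
  have hsum : ∑ x : Σ j : Fin n, Fin (T j).toList.length, (T x.1).toList.get x.2 = ∑ j, m j := by
    rw [Fintype.sum_sigma]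
    refine Finset.sum_congr rfl fun j _ => ?_
    refine (sum_get_toList (T j)).trans ?_
    rw [hT, Multiset.sum_singleton]
  obtain ⟨x₀, -⟩ := hsurj 0
  have : Nonempty (Σ j : Fin n, Fin (T j).toList.length) := ⟨x₀⟩
  have hE := abs_Emap_le_of_two_le (fun x : Σ j : Fin n, Fin (T j).toList.length =>
    (T x.1).toList.get x.2) Finset.univ fun x _ => by rw [hval x]; exact hm _
  rw [hcoeff, mul_one, innerMulti_eq_innerSingle hsurj (by rw [hcι, Fintype.card_fin]),
    innerSingle]
  have hsumZ : (∑ x : Σ j : Fin n, Fin (T j).toList.length, ((T x.1).toList.get x.2 : ℤ)) =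
      ∑ j, (m j : ℤ) := by exact_mod_cast hsum
  rw [hsumZ, hsum, Finset.card_univ, hcι, add_sub_cancel_left]
  rw [hsum] at hE
  exact hE

end Main

/-- Let `g > 1` and let `m = (m₁, …, m_n)` be a partition
(a nonincreasing tuple) of `2g + n − 2` with every `m_i ≥ 2`.  Then
`|⟨F_{m₁} | ⋯ | F_{m_n}⟩ − |m|! · 𝔷(|m| − n + 2)| ≤ 2^{2^{190}} · (|m| − 1)!`. -/
theorem abs_innerF_sub_le (g n : ℕ) (hg : 1 < g) (m : Fin n → ℕ)
    (hm : ∀ i, 2 ≤ m i) (hanti : ∀ i j : Fin n, i ≤ j → m j ≤ m i)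
    (hsum : ∑ i, m i = 2 * g + n - 2) :
    |innerF m - ((∑ i, m i)! : ℝ) * zed ((∑ i, m i : ℤ) - n + 2)| ≤
      2 ^ (2 ^ 190) * (((∑ i, m i) - 1)! : ℝ) := by
  have hn : n ≠ 0 := by
    rintro rfl
    simp only [Finset.univ_eq_empty, Finset.sum_empty] at hsum
    omega
  have : NeZero n := ⟨hn⟩
  have hmax : ∀ j, m j ≤ m 0 := fun j => hanti 0 j (Fin.zero_le _)
  have hT₀ : (fun j => ({m j} : Multiset ℕ)) ∈
      Fintype.piFinset fun j : Fin n => partitionsOfWeight (m j + 1) :=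
    Fintype.mem_piFinset.2 fun j =>
      singleton_mem_partitionsOfWeight (by have := hm j; omega)
  rw [innerF_eq_sum, ← Finset.add_sum_erase _ _ hT₀, add_sub_right_comm]
  have hmain := abs_main_summand_sub_le hm rfl
  have hrest := (Finset.sum_le_sum fun T hT => abs_summand_le hm hmax
    (fun j => Fintype.mem_piFinset.1 (Finset.mem_of_mem_erase hT) j)
    (Finset.ne_of_mem_erase hT)).trans (Finset.sum_le_sum_of_subset_of_nonneg
      (Finset.erase_subset (fun j => ({m j} : Multiset ℕ))
        (Fintype.piFinset fun j : Fin n => partitionsOfWeight (m j + 1)))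
      fun T _ _ => mul_nonneg (by positivity) (Finset.prod_nonneg fun j _ =>
        mul_nonneg (by positivity) (deletedWeight_nonneg _)))
  rw [← Finset.mul_sum] at hrest
  have hrest' := hrest.trans (mul_le_mul_of_nonneg_left
    (sum_prod_deletedWeight_le hm (by positivity)) (by positivity))
  have hfac : (0 : ℝ) ≤ ((∑ i, m i - 1)! : ℝ) := by positivity
  have hconst : (56 * 9 ^ 36 : ℝ) +
      2 * 9 ^ 36 * Real.exp (12 * (2 * 9 ^ 36 * 71 ^ 2 * 336 * 16)) ≤ 2 ^ (2 ^ 190) :=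
    add_mul_exp_le_two_pow rfl (by norm_num)
  refine (abs_add_le _ _).trans ((add_le_add hmain
    ((Finset.abs_sum_le_sum_abs _ _).trans hrest')).trans ?_)
  refine le_trans (le_of_eq ?_) (mul_le_mul_of_nonneg_right hconst hfac)
  ring
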